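/- Any homeomorphism between two arcs in the plane ℝ² can be extended to a homeomorphism of ℝ² onto itself. -/

import Mathlib

section
open Set Filter Topology Complex

namespace ArcExt

/-- A continuous family of nonvanishing functions starting at `1` ends at a function
with a continuous logarithm. -/
lemma log_homotopy {X : Type*} [TopologicalSpace X] (F : unitInterval × X → ℂ)
    (hF : Continuous F) (h0 : ∀ p, F p ≠ 0) (h1 : ∀ x, F (0, x) = 1) :
    ∃ L : X → ℂ, Continuous L ∧ ∀ x, exp (L x) = F (1, x) := by
  let H : C(unitInterval × X, {z : ℂ // z ≠ 0}) :=
    ⟨fun p => ⟨F p, h0 p⟩, by fun_prop⟩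
  let f : C(X, ℂ) := .const X 0
  have H0 : ∀ a, H (0, a) = (⟨_, (f a).exp_ne_zero⟩ : {z : ℂ // z ≠ 0}) := by
    intro a
    apply Subtype.ext
    simp [H, f, h1]
  refine ⟨fun x => isCoveringMap_exp.liftHomotopy H f H0 (1, x), ?_, ?_⟩
  · exact (isCoveringMap_exp.liftHomotopy H f H0).continuous.comp (by fun_prop)
  · intro x
    have := congr_fun (isCoveringMap_exp.liftHomotopy_lifts H f H0) (1, x)
    exact congr_arg Subtype.val this

/-- `f` has a continuous logarithm on `K`. -/
def HasLog (f : ℂ → ℂ) (K : Set ℂ) : Prop :=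
  ∃ L : ℂ → ℂ, ContinuousOn L K ∧ ∀ z ∈ K, exp (L z) = f z

/-- `p` and `q` are not separated by `K`. -/
def NS (K : Set ℂ) (p q : ℂ) : Prop :=
  ∃ W : Set ℂ, IsPreconnected W ∧ W ⊆ Kᶜ ∧ p ∈ W ∧ q ∈ W

lemma NS.symm {K : Set ℂ} {p q : ℂ} (h : NS K p q) : NS K q p := by
  obtain ⟨W, h1, h2, h3, h4⟩ := h
  exact ⟨W, h1, h2, h4, h3⟩

lemma NS.mono {K K' : Set ℂ} {p q : ℂ} (h : NS K p q) (hK : K' ⊆ K) : NS K' p q := by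
  obtain ⟨W, h1, h2, h3, h4⟩ := h
  exact ⟨W, h1, h2.trans (compl_subset_compl.2 hK), h3, h4⟩

lemma hasLog_of_subtype {f : ℂ → ℂ} {K : Set ℂ}
    (h : ∃ L : K → ℂ, Continuous L ∧ ∀ z : K, exp (L z) = f z) : HasLog f K := by
  classical
  obtain ⟨L, hL, he⟩ := h
  refine ⟨fun z => if hz : z ∈ K then L ⟨z, hz⟩ else 0, ?_, ?_⟩
  · rw [continuousOn_iff_continuous_domRestrict]
    convert! hL with z
    simp
  · intro z hz
    simpa [hz] using he ⟨z, hz⟩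

/-- Two logarithms of the same function on a preconnected set which agree at a point agree. -/
lemma log_diff_const {X : Type*} [TopologicalSpace X] {K : Set X} (hK : IsPreconnected K)
    {L M : X → ℂ}
    (hL : ContinuousOn L K) (hM : ContinuousOn M K) (h : ∀ z ∈ K, exp (L z) = exp (M z))
    {x y : X} (hx : x ∈ K) (hy : y ∈ K) : L x - M x = L y - M y := by
  have key : ∀ z ∈ K, ∃ n : ℤ, L z - M z = n * (2 * Real.pi * I) := by
    intro z hz
    obtain ⟨n, hn⟩ := Complex.exp_eq_exp_iff_exists_int.1 (h z hz)
    exact ⟨n, by rw [hn]; ring⟩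
  have hc : ContinuousOn (fun z => (L z - M z).im / (2 * Real.pi)) K := by
    have := hL.sub hM
    exact (continuous_im.comp_continuousOn this).div_const _
  have hm : MapsTo (fun z => (L z - M z).im / (2 * Real.pi)) K (range ((↑) : ℤ → ℝ)) := by
    intro z hz
    obtain ⟨n, hn⟩ := key z hz
    refine ⟨n, ?_⟩
    simp only [hn]
    simp
  have hdisc : IsDiscrete (range ((↑) : ℤ → ℝ)) := by
    have := Int.isClosedEmbedding_coe_real.isEmbedding
    exact ⟨(this.toHomeomorph.symm.isEmbedding.discreteTopology)⟩
  have := hK.constant_of_mapsTo hdisc hc hm hx hy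
  obtain ⟨n, hn⟩ := key x hx
  obtain ⟨m, hm⟩ := key y hy
  simp only [hn, hm] at this ⊢
  simp at this
  rw [this]

/-- If `p` and `q` are joined by a path off `K` then `(z-p)/(z-q)` has a logarithm on `K`. -/
lemma hasLog_of_NS {K : Set ℂ} (hK : IsClosed K) {p q : ℂ} (h : NS K p q) :
    HasLog (fun z => (z - p) / (z - q)) K := by
  obtain ⟨W, hW, hWK, hp, hq⟩ := h
  have hC : IsConnected (connectedComponentIn Kᶜ q) :=
    isConnected_connectedComponentIn_iff.2 (hWK hq)
  have hpC : p ∈ connectedComponentIn Kᶜ q := hW.subset_connectedComponentIn hq hWK hp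
  have hqC : q ∈ connectedComponentIn Kᶜ q := mem_connectedComponentIn (hWK hq)
  have hP : IsPathConnected (connectedComponentIn Kᶜ q) :=
    (hK.isOpen_compl.connectedComponentIn).isConnected_iff_isPathConnected.1 hC
  obtain ⟨σ, hσ⟩ := hP.joinedIn q hqC p hpC
  have hσK : ∀ t, σ t ∉ K := fun t => connectedComponentIn_subset _ _ (hσ t)
  apply hasLog_of_subtype
  have hz : ∀ (t) (z : K), (z : ℂ) - σ t ≠ 0 := by
    intro t z hz
    exact hσK t (by rw [← sub_eq_zero.1 hz]; exact z.2)
  have hq' : ∀ (z : K), (z : ℂ) - q ≠ 0 := by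
    intro z; simpa using hz 0 z
  obtain ⟨L, hL, he⟩ := log_homotopy (X := K) (fun P => ((P.2 : ℂ) - σ P.1) / (P.2 - q))
    (by
      refine Continuous.div (by fun_prop) (by fun_prop) (fun P => hq' P.2))
    (fun P => div_ne_zero (hz _ _) (hq' _)) (fun z => by simp [hq' z])
  exact ⟨L, hL, fun z => by rw [he z]; simp⟩

/-- `z - p` has no continuous logarithm on a circle about `p`. -/
lemma no_log_circle {p : ℂ} {R : ℝ} (hR : 0 < R) {L : ℂ → ℂ} (hL : Continuous L)
    (h : ∀ θ : ℝ, exp (L (p + R * exp (θ * I))) = R * exp (θ * I)) : False := by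
  have hR' : (R : ℂ) ≠ 0 := by exact_mod_cast hR.ne'
  have := log_diff_const (K := (univ : Set ℝ)) isPreconnected_univ
    (L := fun θ : ℝ => L (p + R * exp (θ * I))) (M := fun θ : ℝ => Complex.log R + θ * I)
    (by fun_prop) (by fun_prop)
    (fun θ _ => by rw [h, exp_add, exp_log hR']) (mem_univ 0) (mem_univ (2 * Real.pi))
  simp at this

/-- The hard half of Eilenberg's criterion, bounded component case. -/
lemma eil_bdd {K : Set ℂ} (hK : IsCompact K) {p q : ℂ} (hp : p ∉ K)
    (h : HasLog (fun z => (z - p) / (z - q)) K)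
    (hb : Bornology.IsBounded (connectedComponentIn Kᶜ p))
    (hq : q ∉ connectedComponentIn Kᶜ p) (hqK : q ∉ K) : False := by
  classical
  obtain ⟨L, hL, he⟩ := h
  set V := connectedComponentIn Kᶜ p with hV
  have hVo : IsOpen V := hK.isClosed.isOpen_compl.connectedComponentIn
  have hpV : p ∈ V := mem_connectedComponentIn hp
  have hfr : frontier V ⊆ K := by
    intro z hz
    by_contra hzK
    have hzV : z ∉ V := by
      rw [hVo.frontier_eq] at hz
      exact hz.2
    have ho : IsOpen (connectedComponentIn Kᶜ z) :=
      hK.isClosed.isOpen_compl.connectedComponentIn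
    have hzc : z ∈ closure V := frontier_subset_closure hz
    obtain ⟨w, hw1, hw2⟩ := mem_closure_iff.1 hzc _ ho (mem_connectedComponentIn hzK)
    have e1 := connectedComponentIn_eq hw1
    have e2 := connectedComponentIn_eq hw2
    apply hzV
    rw [hV, e2, ← e1]
    exact mem_connectedComponentIn hzK
  obtain ⟨G, hG⟩ := ContinuousMap.exists_restrict_eq hK.isClosed
    (⟨K.domRestrict L, continuousOn_iff_continuous_domRestrict.1 hL⟩ : C(K, ℂ))
  have hGL : ∀ z ∈ K, G z = L z := fun z hz => by
    have := DFunLike.congr_fun hG ⟨z, hz⟩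
    simpa using this
  let F : ℂ → ℂ := fun z => if z ∈ V then (z - q) * exp (G z) else z - p
  have hFc : Continuous F := by
    apply Continuous.if
    · intro z hz
      have hzK : z ∈ K := hfr hz
      have : z - q ≠ 0 := fun h0 => hqK (by rw [← sub_eq_zero.1 h0]; exact hzK)
      rw [hGL z hzK, he z hzK]
      field_simp
    · fun_prop
    · fun_prop
  have hF0 : ∀ z, F z ≠ 0 := by
    intro z
    by_cases hz : z ∈ V
    · simp only [F, hz, if_true]
      refine mul_ne_zero (fun h0 => hq (by rw [← sub_eq_zero.1 h0]; exact hz)) (exp_ne_zero _)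
    · simp only [F, hz, if_false]
      exact fun h0 => hz (by rw [sub_eq_zero.1 h0]; exact hpV)
  have hsc : IsSimplyConnected (univ : Set ℂ) := by
    have : ContractibleSpace (univ : Set ℂ) :=
      (convex_univ (𝕜 := ℝ)).contractibleSpace univ_nonempty
    exact SimplyConnectedSpace.ofContractible _
  obtain ⟨M, hM, hMe⟩ := exists_continuousOn_eqOn_exp_comp hsc isOpen_univ
    (g := F) hFc.continuousOn (by simpa using fun z => hF0 z)
  obtain ⟨R, hR⟩ := hb.subset_ball p
  have hR0 : 0 < R := by
    have := hR hpV
    simpa using this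
  apply no_log_circle (p := p) hR0 (continuousOn_univ.1 hM)
  intro θ
  have h1 : p + R * exp (θ * I) ∉ V := by
    intro hmem
    have := hR hmem
    simp [abs_of_pos hR0] at this
  have h2 := hMe (mem_univ (p + R * exp (θ * I)))
  simp only [Function.comp_apply] at h2
  rw [h2]
  simp [F, h1]

lemma isPreconnected_compl_ball (c : ℂ) (r : ℝ) (hr : 0 ≤ r) : IsPreconnected (Metric.ball c r)ᶜ := by
  have : (Metric.ball c r)ᶜ =
      (fun x : ℝ × ℝ => c + x.1 * exp (x.2 * I)) '' (Ici r ×ˢ univ) := by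
    ext z
    simp only [mem_compl_iff, Metric.mem_ball, not_lt, mem_image, mem_prod, mem_Ici, mem_univ,
      and_true, Prod.exists, dist_eq_norm]
    constructor
    · intro h
      exact ⟨‖z - c‖, arg (z - c), h, by simp⟩
    · rintro ⟨s, t, hs, rfl⟩
      simp [abs_of_nonneg (hr.trans hs), hs]
  rw [this]
  apply IsPreconnected.image
  · exact isPreconnected_Ici.prod isPreconnected_univ
  · fun_prop

/-- Eilenberg's criterion. -/
lemma NS_of_hasLog {K : Set ℂ} (hK : IsCompact K) {p q : ℂ} (hp : p ∉ K) (hq : q ∉ K)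
    (h : HasLog (fun z => (z - p) / (z - q)) K) : NS K p q := by
  by_contra hns
  have h1 : q ∉ connectedComponentIn Kᶜ p := fun hmem =>
    hns ⟨_, isPreconnected_connectedComponentIn, connectedComponentIn_subset _ _,
      mem_connectedComponentIn hp, hmem⟩
  have h2 : p ∉ connectedComponentIn Kᶜ q := fun hmem =>
    hns ⟨_, isPreconnected_connectedComponentIn, connectedComponentIn_subset _ _,
      hmem, mem_connectedComponentIn hq⟩
  have hb1 : ¬ Bornology.IsBounded (connectedComponentIn Kᶜ p) := fun hb => eil_bdd hK hp h hb h1 hq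
  have hb2 : ¬ Bornology.IsBounded (connectedComponentIn Kᶜ q) := by
    intro hb
    refine eil_bdd hK hq ?_ hb h2 hp
    obtain ⟨L, hL, he⟩ := h
    refine ⟨fun z => - L z, hL.neg, fun z hz => ?_⟩
    rw [exp_neg, he z hz, inv_div]
  obtain ⟨R, hR⟩ := hK.isBounded.subset_ball 0
  have hpc := isPreconnected_compl_ball 0 (max R 0) (le_max_right _ _)
  have hsub : (Metric.ball (0 : ℂ) (max R 0))ᶜ ⊆ Kᶜ :=
    compl_subset_compl.2 (hR.trans (Metric.ball_subset_ball (le_max_left _ _)))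
  have key : ∀ x, ¬ Bornology.IsBounded (connectedComponentIn Kᶜ x) →
      ∃ y ∈ connectedComponentIn Kᶜ x, y ∈ (Metric.ball (0 : ℂ) (max R 0))ᶜ := by
    intro x hx
    by_contra! hcon
    exact hx (Metric.isBounded_ball.subset (fun y hy => not_not.1 (hcon y hy)))
  obtain ⟨y, hy1, hy2⟩ := key p hb1
  obtain ⟨w, hw1, hw2⟩ := key q hb2
  apply h1
  rw [connectedComponentIn_eq hy1, connectedComponentIn_eq (hpc.subset_connectedComponentIn hy2 hsub hw2),
    ← connectedComponentIn_eq hw1]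
  exact mem_connectedComponentIn hq

/-- Janiszewski's theorem. -/
lemma janiszewski {K₁ K₂ : Set ℂ} (h₁ : IsCompact K₁) (h₂ : IsCompact K₂)
    (hc : IsPreconnected (K₁ ∩ K₂)) {p q : ℂ} (n₁ : NS K₁ p q) (n₂ : NS K₂ p q) :
    NS (K₁ ∪ K₂) p q := by
  classical
  have hp : p ∉ K₁ ∪ K₂ := by
    obtain ⟨W, -, h1, h2, -⟩ := n₁
    obtain ⟨W', -, h1', h2', -⟩ := n₂
    exact fun h => h.elim (h1 h2) (h1' h2')
  have hq : q ∉ K₁ ∪ K₂ := by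
    obtain ⟨W, -, h1, -, h2⟩ := n₁
    obtain ⟨W', -, h1', -, h2'⟩ := n₂
    exact fun h => h.elim (h1 h2) (h1' h2')
  apply NS_of_hasLog (h₁.union h₂) hp hq
  obtain ⟨L₁, hL₁, e₁⟩ := hasLog_of_NS h₁.isClosed n₁
  obtain ⟨L₂, hL₂, e₂⟩ := hasLog_of_NS h₂.isClosed n₂
  obtain ⟨c, hce, hcc⟩ : ∃ c : ℂ, exp c = 1 ∧ ∀ z ∈ K₁ ∩ K₂, L₁ z = L₂ z + c := by
    rcases (K₁ ∩ K₂).eq_empty_or_nonempty with h0 | ⟨x, hx⟩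
    · exact ⟨0, by simp, by simp [h0]⟩
    · refine ⟨L₁ x - L₂ x, ?_, fun z hz => ?_⟩
      · rw [exp_sub, e₁ x hx.1, ← e₂ x hx.2, div_self (exp_ne_zero _)]
      · rw [← log_diff_const hc (hL₁.mono inter_subset_left) (hL₂.mono inter_subset_right)
          (fun z hz => by rw [e₁ z hz.1, e₂ z hz.2]) hz hx]
        ring
  let L : ℂ → ℂ := fun z => if z ∈ K₁ then L₁ z else L₂ z + c
  have hl1 : EqOn L L₁ K₁ := fun z hz => by simp [L, hz]
  have hl2 : EqOn L (fun z => L₂ z + c) K₂ := fun z hz => by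
    by_cases h1 : z ∈ K₁
    · simp [L, h1, hcc z ⟨h1, hz⟩]
    · simp [L, h1]
  refine ⟨L, ?_, ?_⟩
  · apply ContinuousOn.union_of_isClosed _ _ h₁.isClosed h₂.isClosed
    · exact hL₁.congr hl1
    · exact (hL₂.add continuousOn_const).congr hl2
  · rintro z (hz | hz)
    · rw [hl1 hz, e₁ z hz]
    · rw [hl2 hz, exp_add, hce, mul_one, e₂ z hz]

/-- An arc does not separate the plane. -/
lemma NS_arc {γ : ℝ → ℂ} (hγ : Continuous γ) {e : ℂ → ℝ}
    (he : ContinuousOn e (γ '' Icc 0 1)) (heγ : ∀ t ∈ Icc (0:ℝ) 1, e (γ t) = t) {p q : ℂ}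
    (hp : p ∉ γ '' Icc 0 1) (hq : q ∉ γ '' Icc 0 1) : NS (γ '' Icc 0 1) p q := by
  apply NS_of_hasLog (isCompact_Icc.image hγ) hp hq
  have hp' : ∀ t ∈ Icc (0:ℝ) 1, γ t - p ≠ 0 := fun t ht h0 =>
    hp ⟨t, ht, sub_eq_zero.1 h0⟩
  have hq' : ∀ t ∈ Icc (0:ℝ) 1, γ t - q ≠ 0 := fun t ht h0 =>
    hq ⟨t, ht, sub_eq_zero.1 h0⟩
  have hmul : ∀ s t : unitInterval, (s * t : ℝ) ∈ Icc (0:ℝ) 1 := fun s t => (s * t).2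
  have h0 : (0:ℝ) ∈ Icc (0:ℝ) 1 := by simp
  obtain ⟨L, hL, hLe⟩ := log_homotopy (X := unitInterval)
    (fun P => ((γ (P.1 * P.2) - p) / (γ (P.1 * P.2) - q)) / ((γ 0 - p) / (γ 0 - q)))
    (by
      apply Continuous.div_const
      refine Continuous.div (by fun_prop) (by fun_prop) (fun P => hq' _ (hmul _ _)))
    (fun P => div_ne_zero (div_ne_zero (hp' _ (hmul _ _)) (hq' _ (hmul _ _)))
      (div_ne_zero (hp' _ h0) (hq' _ h0)))
    (fun x => by simpa using ⟨hp' _ h0, hq' _ h0⟩)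
  have hc0 : (γ 0 - p) / (γ 0 - q) ≠ 0 := div_ne_zero (hp' _ h0) (hq' _ h0)
  refine ⟨fun z => L (projIcc 0 1 zero_le_one (e z)) + Complex.log ((γ 0 - p) / (γ 0 - q)), ?_, ?_⟩
  · refine ContinuousOn.add ?_ continuousOn_const
    exact (hL.comp continuous_projIcc).comp_continuousOn he
  · rintro _ ⟨t, ht, rfl⟩
    rw [exp_add, exp_log hc0, hLe, heγ t ht, projIcc_of_mem _ ht]
    simp only [Icc.coe_one, one_mul]
    exact div_mul_cancel₀ _ hc0

end ArcExt

end

section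
open Set Filter Topology Complex

namespace ArcExt

lemma not_eventually_const {U : Set ℂ} (hU : IsOpen U) {h : ℂ → ℂ} (hi : InjOn h U) {z : ℂ}
    (hz : z ∈ U) : ¬ ∀ᶠ w in 𝓝 z, h w = h z := by
  intro hc
  have h1 : ∀ᶠ w in 𝓝 z, w = z := by
    filter_upwards [hc, hU.mem_nhds hz] with w hw hwU
    exact hi hwU hz hw
  have h2 : ∀ᶠ w in 𝓝[≠] z, w = z := h1.filter_mono nhdsWithin_le_nhds
  have h3 : ∀ᶠ w in 𝓝[≠] z, w ≠ z := eventually_mem_nhdsWithin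
  obtain ⟨w, hw1, hw2⟩ := (h2.and h3).exists
  exact hw2 hw1

lemma holo_open {U : Set ℂ} (hU : IsOpen U) {h : ℂ → ℂ} (hd : DifferentiableOn ℂ h U)
    (hi : InjOn h U) {z : ℂ} (hz : z ∈ U) : 𝓝 (h z) ≤ map h (𝓝 z) := by
  have ha : AnalyticAt ℂ h z := hd.analyticAt (hU.mem_nhds hz)
  exact ha.eventually_constant_or_nhds_le_map_nhds.resolve_left (not_eventually_const hU hi hz)

lemma holo_image_open {U : Set ℂ} (hU : IsOpen U) {h : ℂ → ℂ} (hd : DifferentiableOn ℂ h U)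
    (hi : InjOn h U) : IsOpen (h '' U) := by
  rw [isOpen_iff_mem_nhds]
  rintro _ ⟨z, hz, rfl⟩
  exact holo_open hU hd hi hz (image_mem_map (hU.mem_nhds hz))

/-- The inverse of an injective holomorphic map is holomorphic. -/
lemma holo_inverse {U : Set ℂ} (hU : IsOpen U) {h : ℂ → ℂ} (hd : DifferentiableOn ℂ h U)
    (hi : InjOn h U) : ∃ g : ℂ → ℂ, DifferentiableOn ℂ g (h '' U) ∧ ∀ z ∈ U, g (h z) = z := by
  obtain ⟨g, hg⟩ : ∃ g : ℂ → ℂ, ∀ z ∈ U, g (h z) = z :=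
    ⟨Function.invFunOn h U, fun z hz => hi.leftInvOn_invFunOn hz⟩
  have hVo := holo_image_open hU hd hi
  have hgc : ∀ z ∈ U, ContinuousAt g (h z) := by
    intro z hz
    rw [ContinuousAt, hg z hz]
    intro N hN
    have : h '' (N ∩ U) ∈ 𝓝 (h z) :=
      holo_open hU hd hi hz (image_mem_map (inter_mem hN (hU.mem_nhds hz)))
    rw [mem_map]
    filter_upwards [this]
    rintro _ ⟨w, hw, rfl⟩
    rw [mem_preimage, hg w hw.2]
    exact hw.1
  have hgd : ∀ z ∈ U, deriv h z ≠ 0 → DifferentiableAt ℂ g (h z) := by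
    intro z hz hz0
    have h1 : HasDerivAt h (deriv h z) (g (h z)) := by
      rw [hg z hz]
      exact (hd.differentiableAt (hU.mem_nhds hz)).hasDerivAt
    refine (h1.of_local_left_inverse (hgc z hz) hz0 ?_).differentiableAt
    filter_upwards [hVo.mem_nhds (mem_image_of_mem h hz)]
    rintro _ ⟨w, hw, rfl⟩
    rw [hg w hw]
  refine ⟨g, ?_, hg⟩
  rintro _ ⟨z, hz, rfl⟩
  apply DifferentiableAt.differentiableWithinAt
  have ha : AnalyticAt ℂ h z := hd.analyticAt (hU.mem_nhds hz)
  rcases ha.deriv.eventually_eq_zero_or_eventually_ne_zero with h0 | h0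
  · exfalso
    apply not_eventually_const hU hi hz
    obtain ⟨r, hr, hball⟩ := Metric.eventually_nhds_iff_ball.1 (h0.and (hU.eventually_mem hz))
    filter_upwards [Metric.ball_mem_nhds z hr] with w hw
    refine (convex_ball z r).is_const_of_fderivWithin_eq_zero (𝕜 := ℂ)
      (hd.mono fun x hx => (hball x hx).2) ?_ hw (Metric.mem_ball_self hr)
    intro x hx
    rw [fderivWithin_of_isOpen Metric.isOpen_ball hx]
    ext
    simpa using (hball x hx).1
  · refine (analyticAt_of_differentiable_on_punctured_nhds_of_continuousAt ?_
      (hgc z hz)).differentiableAt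
    have ht : Tendsto g (𝓝[≠] (h z)) (𝓝[≠] z) := by
      apply tendsto_nhdsWithin_of_tendsto_nhds_of_eventually_within
      · have := (hgc z hz).tendsto
        rw [hg z hz] at this
        exact this.mono_left nhdsWithin_le_nhds
      · filter_upwards [self_mem_nhdsWithin,
          mem_nhdsWithin_of_mem_nhds (hVo.mem_nhds (mem_image_of_mem h hz))]
        rintro _ hw ⟨x, hx, rfl⟩
        rw [hg x hx]
        rintro rfl
        exact hw rfl
    filter_upwards [ht.eventually h0,
      mem_nhdsWithin_of_mem_nhds (hVo.mem_nhds (mem_image_of_mem h hz))]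
    rintro _ hw ⟨x, hx, rfl⟩
    rw [hg x hx] at hw
    exact hgd x hx hw

/-- `V` has (at most) one end. -/
def OneEnded (V : Set ℂ) : Prop :=
  ∀ K ⊆ V, IsCompact K → ∃ K', IsCompact K' ∧ K ⊆ K' ∧ K' ⊆ V ∧ IsPreconnected (V \ K')

lemma OneEnded.image {U : Set ℂ} (hU : OneEnded U) {h g : ℂ → ℂ} (hc : ContinuousOn h U)
    (gc : ContinuousOn g (h '' U)) (hg : ∀ z ∈ U, g (h z) = z) : OneEnded (h '' U) := by
  intro K hK hKc
  have hi : InjOn h U := fun x hx y hy hxy => by rw [← hg x hx, hxy, hg y hy]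
  have hgK : g '' K ⊆ U := by
    rintro _ ⟨w, hw, rfl⟩
    obtain ⟨z, hz, rfl⟩ := hK hw
    rwa [hg z hz]
  obtain ⟨K', h1, h2, h3, h4⟩ := hU (g '' K) hgK (hKc.image_of_continuousOn (gc.mono hK))
  refine ⟨h '' K', h1.image_of_continuousOn (hc.mono h3), ?_, image_mono h3, ?_⟩
  · intro w hw
    obtain ⟨z, hz, rfl⟩ := hK hw
    exact ⟨z, h2 ⟨_, hw, hg z hz⟩, rfl⟩
  · rw [← hi.image_sdiff_subset h3]
    exact h4.image _ (hc.mono sdiff_subset)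

lemma OneEnded.NS {V : Set ℂ} (hV : OneEnded V) (ho : IsOpen V) {p q : ℂ} (hp : p ∉ V) (hq : q ∉ V)
    {K : Set ℂ} (hK : IsCompact K) (hKV : K ⊆ V) : NS K p q := by
  obtain ⟨K', h1, h2, h3, h4⟩ := hV K hKV hK
  refine NS.mono ?_ h2
  have hpK : p ∉ K' := fun h => hp (h3 h)
  have hqK : q ∉ K' := fun h => hq (h3 h)
  by_contra hns
  have hne : connectedComponentIn K'ᶜ p ≠ connectedComponentIn K'ᶜ q := by
    intro heq
    apply hns
    refine ⟨_, isPreconnected_connectedComponentIn, connectedComponentIn_subset _ _,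
      mem_connectedComponentIn hpK, ?_⟩
    rw [heq]
    exact mem_connectedComponentIn hqK
  have key : ∀ x, x ∉ K' → (V ∩ connectedComponentIn K'ᶜ x).Nonempty := by
    intro x hx
    by_contra hem
    set C := connectedComponentIn K'ᶜ x with hC
    have hCo : IsOpen C := h1.isClosed.isOpen_compl.connectedComponentIn
    have hCcl : IsClosed C := by
      rw [← closure_subset_iff_isClosed]
      intro z hz
      by_contra hzC
      have hzK : z ∈ K' := by
        by_contra hzK
        have ho : IsOpen (connectedComponentIn K'ᶜ z) :=
          h1.isClosed.isOpen_compl.connectedComponentIn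
        obtain ⟨w, hw1, hw2⟩ := mem_closure_iff.1 hz _ ho (mem_connectedComponentIn hzK)
        apply hzC
        rw [hC, connectedComponentIn_eq hw2, ← connectedComponentIn_eq hw1]
        exact mem_connectedComponentIn hzK
      obtain ⟨w, hw1, hw2⟩ := mem_closure_iff.1 hz V ho (h3 hzK)
      exact hem ⟨w, hw1, hw2⟩
    have huniv : C = univ :=
      IsClopen.eq_univ ⟨hCcl, hCo⟩ ⟨x, mem_connectedComponentIn hx⟩
    apply hne
    rw [← connectedComponentIn_eq (x := x) (y := p) (F := K'ᶜ) (by rw [← hC, huniv]; trivial),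
      ← connectedComponentIn_eq (x := x) (y := q) (F := K'ᶜ) (by rw [← hC, huniv]; trivial)]
  obtain ⟨x, hxV, hx⟩ := key p hpK
  obtain ⟨y, hyV, hy⟩ := key q hqK
  have hxK := connectedComponentIn_subset _ _ hx
  have hyK := connectedComponentIn_subset _ _ hy
  have := h4.subset_connectedComponentIn (F := K'ᶜ) ⟨hxV, hxK⟩ (fun z hz => hz.2) ⟨hyV, hyK⟩
  apply hne
  rw [connectedComponentIn_eq hx, connectedComponentIn_eq this, connectedComponentIn_eq hy]

lemma hasLog_glue {V : Set ℂ} (ho : IsOpen V) (hc : IsConnected V) {f : ℂ → ℂ}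
    (h : ∀ K ⊆ V, IsCompact K → HasLog f K) : HasLog f V := by
  classical
  have hP : IsPathConnected V := ho.isConnected_iff_isPathConnected.1 hc
  obtain ⟨v, hv⟩ := hc.nonempty
  have hK : ∀ x : V, ∃ K ⊆ V, IsCompact K ∧ IsPreconnected K ∧ v ∈ K ∧ (x : ℂ) ∈ K := by
    intro x
    obtain ⟨σ, hσ⟩ := hP.joinedIn v hv x x.2
    refine ⟨range σ, by rintro _ ⟨t, rfl⟩; exact hσ t, isCompact_range σ.continuous,
      isPreconnected_range σ.continuous, ⟨0, by simp⟩, ⟨1, by simp⟩⟩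
  have hnorm : ∀ K ⊆ V, IsCompact K → v ∈ K →
      ∃ L : ℂ → ℂ, ContinuousOn L K ∧ (∀ z ∈ K, exp (L z) = f z) ∧ L v = Complex.log (f v) := by
    intro K hKV hKc hvK
    obtain ⟨L, hL, he⟩ := h K hKV hKc
    have hf0 : f v ≠ 0 := by rw [← he v hvK]; exact exp_ne_zero _
    refine ⟨fun z => L z + (Complex.log (f v) - L v), hL.add continuousOn_const, ?_, by ring⟩
    intro z hz
    rw [exp_add, exp_sub, exp_log hf0, he z hz, he v hvK, div_self hf0, mul_one]
  choose K hKV hKc hKp hvK hxK using hK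
  choose L hL he hLv using fun x => hnorm (K x) (hKV x) (hKc x) (hvK x)
  have uniq : ∀ (K' : Set ℂ) (M : ℂ → ℂ) (x : V), K' ⊆ V → IsPreconnected K' → v ∈ K' →
      IsCompact K' → (x : ℂ) ∈ K' → ContinuousOn M K' → (∀ z ∈ K', exp (M z) = f z) →
      M v = Complex.log (f v) → M x = L x x := by
    intro K' M x hK'V hK'p hvK' hK'c hxK' hM hMe hMv
    obtain ⟨N, hN, hNe, hNv⟩ := hnorm (K' ∪ K x) (union_subset hK'V (hKV x)) (hK'c.union (hKc x))
      (Or.inl hvK')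
    have h1 := log_diff_const hK'p hM (hN.mono subset_union_left)
      (fun z hz => by rw [hMe z hz, hNe z (Or.inl hz)]) hxK' hvK'
    have h2 := log_diff_const (hKp x) (hL x) (hN.mono subset_union_right)
      (fun z hz => by rw [he x z hz, hNe z (Or.inr hz)]) (hxK x) (hvK x)
    rw [hMv, hNv, sub_self] at h1
    rw [hLv, hNv, sub_self] at h2
    rw [sub_eq_zero.1 h1, sub_eq_zero.1 h2]
  apply hasLog_of_subtype
  refine ⟨fun x => L x x, ?_, fun x => he x x (hxK x)⟩
  rw [continuous_iff_continuousAt]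
  intro x
  obtain ⟨r, hr, hball⟩ := Metric.nhds_basis_closedBall.mem_iff.1 (ho.mem_nhds x.2)
  set K' := K x ∪ Metric.closedBall (x : ℂ) r with hK'
  have hxb : (x : ℂ) ∈ Metric.closedBall (x : ℂ) r := Metric.mem_closedBall_self hr.le
  have hK'V : K' ⊆ V := union_subset (hKV x) hball
  have hK'c : IsCompact K' := (hKc x).union (isCompact_closedBall _ _)
  have hK'p : IsPreconnected K' := (hKp x).union (x : ℂ) (hxK x) hxb
    (convex_closedBall _ _).isPreconnected
  obtain ⟨M, hM, hMe, hMv⟩ := hnorm K' hK'V hK'c (Or.inl (hvK x))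
  have hMc : ContinuousAt M x := hM.continuousAt
    (mem_of_superset (Metric.closedBall_mem_nhds _ hr) subset_union_right)
  refine (hMc.comp (continuous_subtype_val.continuousAt)).congr ?_
  have : ∀ᶠ y : V in 𝓝 x, (y : ℂ) ∈ Metric.closedBall (x : ℂ) r :=
    continuous_subtype_val.continuousAt.eventually (Metric.closedBall_mem_nhds _ hr)
  filter_upwards [this] with y hy
  exact uniq K' M y hK'V hK'p (Or.inl (hvK x)) hK'c (Or.inr hy) hM hMe hMv

end ArcExt

end

section
open Set Filter Topology Complex

namespace ArcExt

/-- Uniform Lipschitz bounds for bounded holomorphic functions: normal families. -/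
lemma normal_limit {U : Set ℂ} (hU : IsOpen U) {F : ℕ → ℂ → ℂ}
    (hd : ∀ n, DifferentiableOn ℂ (F n) U) (hb : ∀ n, MapsTo (F n) U (Metric.ball 0 1))
    (l : Ultrafilter ℕ) :
    ∃ f : ℂ → ℂ, TendstoLocallyUniformlyOn F f (l : Filter ℕ) U := by
  have h1 : ∀ z ∈ U, ∃ c, Tendsto (fun n => F n z) l (𝓝 c) := by
    intro z hz
    obtain ⟨c, -, hc⟩ := (isCompact_closedBall (0 : ℂ) 1).ultrafilter_le_nhds
      (l.map (fun n => F n z)) (by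
        rw [le_principal_iff, Ultrafilter.coe_map, mem_map]
        exact Eventually.of_forall fun n => Metric.ball_subset_closedBall (hb n hz))
    exact ⟨c, hc⟩
  choose! f hf using h1
  refine ⟨f, ?_⟩
  rw [Metric.tendstoLocallyUniformlyOn_iff]
  intro ε hε x hx
  obtain ⟨R, hR, hRU⟩ := Metric.isOpen_iff.1 hU x hx
  have hlip : ∀ n, ∀ z ∈ Metric.ball x R, dist (F n z) (F n x) ≤ 2 / R * dist z x := by
    intro n z hz
    refine Complex.dist_le_div_mul_dist_of_mapsTo_ball ((hd n).mono hRU) ?_ hz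
    intro w hw
    have h1 := hb n (hRU hw)
    have h2 := hb n hx
    rw [mem_ball_zero_iff] at h1 h2
    rw [mem_closedBall_iff_norm]
    linarith [norm_sub_le (F n w) (F n x)]
  have hlipf : ∀ z ∈ Metric.ball x R, dist (f z) (f x) ≤ 2 / R * dist z x := by
    intro z hz
    exact le_of_tendsto ((hf z (hRU hz)).dist (hf x hx)) (Eventually.of_forall fun n => hlip n z hz)
  set δ := min R (ε / 4 * (R / 2)) with hδ
  have hδ0 : 0 < δ := lt_min hR (by positivity)
  refine ⟨Metric.ball x δ, mem_nhdsWithin_of_mem_nhds (Metric.ball_mem_nhds x hδ0), ?_⟩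
  filter_upwards [Metric.tendsto_nhds.1 (hf x hx) (ε / 4) (by positivity)] with n hn z hz
  have hzR : z ∈ Metric.ball x R := Metric.ball_subset_ball (min_le_left _ _) hz
  have hzd : dist z x < ε / 4 * (R / 2) := lt_of_lt_of_le hz (min_le_right _ _)
  have hk : 2 / R * dist z x ≤ ε / 4 := by
    have : 2 / R * dist z x ≤ 2 / R * (ε / 4 * (R / 2)) := by gcongr
    refine this.trans (le_of_eq ?_)
    field_simp
  have a1 := hlip n z hzR
  have a2 := hlipf z hzR
  have := dist_triangle4 (f z) (f x) (F n x) (F n z)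
  rw [dist_comm (f x), dist_comm (F n x) (F n z)] at this
  linarith

/-- Hurwitz: a nonconstant locally uniform limit of injective holomorphic maps is injective. -/
lemma hurwitz_inj {U : Set ℂ} (hU : IsOpen U) (hc : IsPreconnected U) {F : ℕ → ℂ → ℂ} {f : ℂ → ℂ}
    {l : Filter ℕ} [l.NeBot]
    (hd : ∀ n, DifferentiableOn ℂ (F n) U) (hi : ∀ n, InjOn (F n) U)
    (hl : TendstoLocallyUniformlyOn F f l U) {p q : ℂ} (hp : p ∈ U) (hq : q ∈ U)
    (hpq : f p ≠ f q) : InjOn f U := by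
  have hfd : DifferentiableOn ℂ f U := hl.differentiableOn (Eventually.of_forall hd) hU
  intro x hx y hy hxy
  by_contra hne
  have hga : AnalyticOnNhd ℂ (fun z => f z - f y) U := (hfd.sub_const _).analyticOnNhd hU
  rcases (hga y hy).eventually_eq_zero_or_eventually_ne_zero with h0 | h0
  · have := hga.eqOn_zero_of_preconnected_of_eventuallyEq_zero hc hy h0
    have e1 := this hp
    have e2 := this hq
    simp only [Pi.zero_apply, sub_eq_zero] at e1 e2
    exact hpq (e1.trans e2.symm)
  · rw [eventually_nhdsWithin_iff] at h0
    have h1 : ∀ᶠ z in 𝓝 y, z ∈ U ∧ z ≠ x ∧ (z ∈ ({y}ᶜ : Set ℂ) → f z - f y ≠ 0) := by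
      filter_upwards [h0, hU.mem_nhds hy, isOpen_ne.mem_nhds (Ne.symm hne)] with z a b c
      exact ⟨b, c, a⟩
    obtain ⟨r, hr, hrU⟩ := Metric.nhds_basis_closedBall.eventually_iff.1 h1
    have hsub : Metric.closedBall y r ⊆ U := fun z hz => (hrU hz).1
    obtain ⟨w, hw, hmin⟩ := (isCompact_sphere y r).exists_isMinOn
      (NormedSpace.sphere_nonempty.2 hr.le) (f := fun z => ‖f z - f y‖)
      ((hfd.continuousOn.mono (Metric.sphere_subset_closedBall.trans hsub)).sub
        continuousOn_const).norm
    set m := ‖f w - f y‖ with hm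
    have hm0 : 0 < m := by
      rw [hm, norm_pos_iff]
      apply (hrU (Metric.sphere_subset_closedBall hw)).2.2
      rintro rfl
      rw [mem_sphere_iff_norm, sub_self, norm_zero] at hw
      exact hr.ne hw
    have hu := (tendstoLocallyUniformlyOn_iff_forall_isCompact hU).1 hl _ hsub
      (isCompact_closedBall y r)
    have hx1 := (tendstoLocallyUniformlyOn_iff_forall_isCompact hU).1 hl {x} (by simpa using hx)
      isCompact_singleton
    rw [Metric.tendstoUniformlyOn_iff] at hu hx1
    obtain ⟨n, hn1, hn2⟩ := ((hu (m / 8) (by positivity)).and (hx1 (m / 8) (by positivity))).exists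
    have hyr : y ∈ Metric.closedBall y r := Metric.mem_closedBall_self hr.le
    have hny := hn1 y hyr
    have hnx := hn2 x rfl
    rw [dist_eq_norm] at hny hnx
    have hsubset := DiffContOnCl.ball_subset_image_closedBall (f := F n) (z₀ := y) (ε := m / 2)
      (r := r) ((hd n).mono (by rwa [closure_ball _ hr.ne'])).diffContOnCl hr (by
        intro z hz
        have h3 := hn1 z (Metric.sphere_subset_closedBall hz)
        rw [dist_eq_norm] at h3
        have h4 : m ≤ ‖f z - f y‖ := hmin hz
        have h5 : f z - f y = (f z - F n z) + (F n z - F n y) - (f y - F n y) := by ring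
        have h6 := norm_sub_le ((f z - F n z) + (F n z - F n y)) (f y - F n y)
        have h7 := norm_add_le (f z - F n z) (F n z - F n y)
        rw [h5] at h4
        linarith) (not_eventually.1 (not_eventually_const hU (hi n) hy))
    have hmem : F n x ∈ Metric.ball (F n y) (m / 2 / 2) := by
      rw [mem_ball_iff_norm]
      have h5 : F n x - F n y = (f y - F n y) - (f x - F n x) := by rw [hxy]; ring
      rw [h5]
      linarith [norm_sub_le (f y - F n y) (f x - F n x)]
    obtain ⟨z, hz, hzx⟩ := hsubset hmem
    exact (hrU hz).2.1 (hi n (hsub hz) hx hzx)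

lemma mob_ne {p w : ℂ} (hp : ‖p‖ < 1) (hw : ‖w‖ < 1) : 1 - (starRingEnd ℂ) p * w ≠ 0 := by
  intro h
  have h1 : ‖(starRingEnd ℂ) p * w‖ < 1 := by
    rw [norm_mul, RCLike.norm_conj]
    nlinarith [norm_nonneg p, norm_nonneg w]
  rw [← sub_eq_zero.1 h] at h1
  simp at h1

lemma mob_lt {p w : ℂ} (hp : ‖p‖ < 1) (hw : ‖w‖ < 1) :
    ‖(w - p) / (1 - (starRingEnd ℂ) p * w)‖ < 1 := by
  rw [norm_div, div_lt_one (norm_pos_iff.2 (mob_ne hp hw))]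
  have h1 : ‖p‖ ^ 2 < 1 := by nlinarith [norm_nonneg p]
  have h2 : ‖w‖ ^ 2 < 1 := by nlinarith [norm_nonneg w]
  have h3 : ‖1 - (starRingEnd ℂ) p * w‖ ^ 2 - ‖w - p‖ ^ 2 = (1 - ‖p‖ ^ 2) * (1 - ‖w‖ ^ 2) := by
    simp only [Complex.sq_norm, Complex.normSq_apply, sub_re, sub_im, mul_re, mul_im, conj_re,
      conj_im, one_re, one_im]
    ring
  have h4 : 0 < (1 - ‖p‖ ^ 2) * (1 - ‖w‖ ^ 2) := mul_pos (by linarith) (by linarith)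
  exact lt_of_pow_lt_pow_left₀ 2 (norm_nonneg _) (by linarith)

/-- A continuous square root of a nonvanishing holomorphic function is holomorphic. -/
lemma holo_sqrt {U : Set ℂ} (hU : IsOpen U) {u g : ℂ → ℂ} (hu : ContinuousOn u U)
    (hg : DifferentiableOn ℂ g U) (h : ∀ z ∈ U, u z ^ 2 = g z) (h0 : ∀ z ∈ U, u z ≠ 0) :
    DifferentiableOn ℂ u U := by
  intro z hz
  apply DifferentiableAt.differentiableWithinAt
  have hgd : HasDerivAt g (deriv g z) z := (hg.differentiableAt (hU.mem_nhds hz)).hasDerivAt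
  have huc : ContinuousAt u z := hu.continuousAt (hU.mem_nhds hz)
  have hne : u z + u z ≠ 0 := by
    rw [← two_mul]; exact mul_ne_zero two_ne_zero (h0 z hz)
  have hs : Tendsto (fun w => u w + u z) (𝓝 z) (𝓝 (u z + u z)) := huc.add_const _
  have hd : HasDerivAt u (deriv g z / (u z + u z)) z := by
    rw [hasDerivAt_iff_tendsto_slope] at hgd ⊢
    refine (hgd.div (hs.mono_left nhdsWithin_le_nhds) hne).congr' ?_
    have e1 : ∀ᶠ w in 𝓝 z, u w + u z ≠ 0 := hs.eventually_ne hne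
    filter_upwards [mem_nhdsWithin_of_mem_nhds e1,
      mem_nhdsWithin_of_mem_nhds (hU.mem_nhds hz), self_mem_nhdsWithin] with w hw1 hw2 hw3
    have hw1' : u w + u z ≠ 0 := hw1
    have hwz : w - z ≠ 0 := sub_ne_zero.2 hw3
    simp only [Pi.div_apply, slope_def_field, ← h w hw2, ← h z hz]
    field_simp
    ring
  exact hd.differentiableAt

/-- The competitors in the extremal problem. -/
def Fam (U : Set ℂ) (h : ℂ → ℂ) : Prop :=
  DifferentiableOn ℂ h U ∧ InjOn h U ∧ MapsTo h U (Metric.ball 0 1) ∧ h 0 = 0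

lemma fam_improve {U : Set ℂ} (hU : IsOpen U) (hc : IsConnected U) (h1 : OneEnded U)
    (h0 : (0 : ℂ) ∈ U) {h : ℂ → ℂ} (hf : Fam U h) {p : ℂ} (hp : ‖p‖ < 1) (hpU : p ∉ h '' U)
    {y : ℂ} (hy : y ∈ U) (hy0 : y ≠ 0) : ∃ k, Fam U k ∧ ‖h y‖ < ‖k y‖ := by
  obtain ⟨hd, hi, hb, hz0⟩ := hf
  have hp0 : p ≠ 0 := by
    rintro rfl
    exact hpU ⟨0, h0, hz0⟩
  set q := ((starRingEnd ℂ) p)⁻¹ with hq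
  have hcp : (starRingEnd ℂ) p ≠ 0 := by simpa using hp0
  have hqn : 1 < ‖q‖ := by
    rw [hq, norm_inv, RCLike.norm_conj]
    exact (one_lt_inv₀ (norm_pos_iff.2 hp0)).2 hp
  have hqU : q ∉ h '' U := by
    rintro ⟨z, hz, hzq⟩
    have := hb hz
    rw [mem_ball_zero_iff, hzq] at this
    linarith
  obtain ⟨g, hgd, hg⟩ := holo_inverse hU hd hi
  have hVo := holo_image_open hU hd hi
  have hV1 := h1.image hd.continuousOn hgd.continuousOn hg
  have hVc : IsConnected (h '' U) := hc.image h hd.continuousOn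
  obtain ⟨L, hL, hLe⟩ := hasLog_glue hVo hVc (f := fun z => (z - p) / (z - q)) (fun K hK hKc =>
    hasLog_of_NS hKc.isClosed (hV1.NS hVo hpU hqU hKc hK))
  obtain ⟨c, hcc⟩ := IsAlgClosed.exists_pow_nat_eq (-((starRingEnd ℂ) p)⁻¹ : ℂ) (n := 2) (by norm_num)
  set u : ℂ → ℂ := fun z => c * exp (L (h z) / 2) with hu
  have huc : ContinuousOn u U := by
    have : ContinuousOn (fun z => L (h z)) U := hL.comp hd.continuousOn (mapsTo_image h U)
    exact continuousOn_const.mul (this.div_const 2).cexp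
  have hn : ∀ z ∈ U, ‖h z‖ < 1 := fun z hz => mem_ball_zero_iff.1 (hb hz)
  have hu2 : ∀ z ∈ U, u z ^ 2 = (h z - p) / (1 - (starRingEnd ℂ) p * h z) := by
    intro z hz
    have e1 : exp (L (h z) / 2) ^ 2 = (h z - p) / (h z - q) := by
      have e0 : exp (L (h z)) = (h z - p) / (h z - q) := hLe _ (mem_image_of_mem h hz)
      rw [← e0, ← Complex.exp_nat_mul]
      congr 1
      push_cast
      ring
    have e2 : h z - q ≠ 0 := by
      intro e
      exact hqU ⟨z, hz, sub_eq_zero.1 e⟩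
    have e3 := mob_ne hp (hn z hz)
    simp only [hu, mul_pow]
    rw [e1, hcc]
    have e4 : 1 - (starRingEnd ℂ) p * h z = - (starRingEnd ℂ) p * (h z - q) := by
      rw [hq]; field_simp; ring
    rw [e4]
    field_simp
  have hc0 : c ≠ 0 := by
    rintro rfl
    simp at hcc
    exact hp0 hcc
  have hu0 : ∀ z ∈ U, u z ≠ 0 := fun z hz => mul_ne_zero hc0 (exp_ne_zero _)
  have hud : DifferentiableOn ℂ u U := by
    refine holo_sqrt hU huc ?_ hu2 hu0
    exact (hd.sub_const _).div ((hd.const_mul _).const_sub _) (fun z hz => mob_ne hp (hn z hz))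
  have hun : ∀ z ∈ U, ‖u z‖ < 1 := by
    intro z hz
    have := mob_lt hp (hn z hz)
    rw [← hu2 z hz, norm_pow] at this
    nlinarith [norm_nonneg (u z)]
  set σ := u 0 with hσ
  have hσn : ‖σ‖ < 1 := hun 0 h0
  have hσ2 : σ ^ 2 = -p := by
    rw [hσ, hu2 0 h0, hz0]; simp
  refine ⟨fun z => (u z - σ) / (1 - (starRingEnd ℂ) σ * u z), ⟨?_, ?_, ?_, ?_⟩, ?_⟩
  · exact (hud.sub_const _).div ((hud.const_mul _).const_sub _)
      (fun z hz => mob_ne hσn (hun z hz))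
  · intro x hx z hz hxz
    simp only at hxz
    rw [div_eq_div_iff (mob_ne hσn (hun x hx)) (mob_ne hσn (hun z hz))] at hxz
    have e1 : (u x - u z) * (1 - (starRingEnd ℂ) σ * σ) = 0 := by linear_combination hxz
    have e2 : u x = u z :=
      sub_eq_zero.1 ((mul_eq_zero.1 e1).resolve_right (mob_ne hσn hσn))
    have e3 : u x ^ 2 = u z ^ 2 := by rw [e2]
    rw [hu2 x hx, hu2 z hz, div_eq_div_iff (mob_ne hp (hn x hx)) (mob_ne hp (hn z hz))] at e3
    have e4 : (h x - h z) * (1 - (starRingEnd ℂ) p * p) = 0 := by linear_combination e3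
    exact hi hx hz (sub_eq_zero.1 ((mul_eq_zero.1 e4).resolve_right (mob_ne hp hp)))
  · intro z hz
    rw [mem_ball_zero_iff]
    exact mob_lt hσn (hun z hz)
  · simp [← hσ]
  · have hhy : h y ≠ 0 := by
      rw [← hz0]
      exact fun e => hy0 (hi hy h0 e)
    have hσn' : ‖-σ‖ < 1 := by rwa [norm_neg]
    have key : h y = (u y - σ) / (1 - (starRingEnd ℂ) σ * u y) *
        ((u y - -σ) / (1 - (starRingEnd ℂ) (-σ) * u y)) := by
      have e1 := mob_ne hσn (hun y hy)
      have e2 := mob_ne hσn' (hun y hy)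
      have e3 := mob_ne hp (hn y hy)
      have e4 := hu2 y hy
      rw [eq_div_iff e3] at e4
      rw [div_mul_div_comm, eq_div_iff (mul_ne_zero e1 e2)]
      have e5 : (starRingEnd ℂ) p = - (starRingEnd ℂ) σ ^ 2 := by
        rw [← map_pow, hσ2]; simp
      rw [e5] at e4
      have e6 : p = -σ ^ 2 := by rw [hσ2]; ring
      rw [e6] at e4
      rw [map_neg]
      linear_combination -e4
    have hk := mob_lt hσn' (hun y hy)
    rw [key, norm_mul]
    have hpos : 0 < ‖(u y - σ) / (1 - (starRingEnd ℂ) σ * u y)‖ := by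
      rw [norm_pos_iff]
      intro e
      rw [key, e, zero_mul] at hhy
      exact hhy rfl
    nlinarith

/-- Riemann mapping theorem for one-ended domains. -/
theorem riemann {U : Set ℂ} (hU : IsOpen U) (hc : IsConnected U) (h1 : OneEnded U)
    (h0 : (0 : ℂ) ∈ U) {k : ℂ → ℂ} (hk : Fam U k) :
    ∃ h, Fam U h ∧ h '' U = Metric.ball 0 1 := by
  obtain ⟨y, hyU, hy0⟩ : ∃ y ∈ U, y ≠ 0 := by
    obtain ⟨r, hr, hrU⟩ := Metric.isOpen_iff.1 hU 0 h0
    refine ⟨((r / 2 : ℝ) : ℂ), hrU ?_, by exact_mod_cast (half_pos hr).ne'⟩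
    rw [mem_ball_zero_iff, Complex.norm_real, Real.norm_of_nonneg (half_pos hr).le]
    linarith
  set S : Set ℝ := {s | ∃ h, Fam U h ∧ s = ‖h y‖} with hS
  have hSne : S.Nonempty := ⟨_, k, hk, rfl⟩
  have hSb : BddAbove S := by
    refine ⟨1, ?_⟩
    rintro _ ⟨h, hh, rfl⟩
    exact (mem_ball_zero_iff.1 (hh.2.2.1 hyU)).le
  obtain ⟨s, -, hst, hs⟩ := exists_seq_tendsto_sSup hSne hSb
  choose F hF hFs using hs
  set l : Ultrafilter ℕ := hyperfilter ℕ with hl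
  obtain ⟨f, hf⟩ := normal_limit hU (fun n => (hF n).1) (fun n => (hF n).2.2.1) l
  have hpt : ∀ z ∈ U, Tendsto (fun n => F n z) l (𝓝 (f z)) := fun z hz => hf.tendsto_at hz
  have hfd : DifferentiableOn ℂ f U := hf.differentiableOn (Eventually.of_forall fun n => (hF n).1) hU
  have hf0 : f 0 = 0 := by
    have := hpt 0 h0
    simp only [(hF _).2.2.2] at this
    exact tendsto_nhds_unique this tendsto_const_nhds
  have hfy : ‖f y‖ = sSup S := by
    have e1 := (hpt y hyU).norm
    simp only [← hFs] at e1
    exact tendsto_nhds_unique e1 (hst.mono_left (Nat.hyperfilter_le_atTop))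
  have hpos : 0 < sSup S := by
    refine lt_of_lt_of_le ?_ (le_csSup hSb ⟨k, hk, rfl⟩)
    rw [norm_pos_iff, ← hk.2.2.2]
    exact fun e => hy0 (hk.2.1 hyU h0 e)
  have hfi : InjOn f U := by
    refine hurwitz_inj hU hc.isPreconnected (fun n => (hF n).1) (fun n => (hF n).2.1) hf hyU h0 ?_
    rw [hf0]
    rw [← hfy, norm_pos_iff] at hpos
    exact hpos
  have hfo := holo_image_open hU hfd hfi
  have hfb : f '' U ⊆ Metric.ball 0 1 := by
    have h1 : f '' U ⊆ Metric.closedBall 0 1 := by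
      rintro _ ⟨z, hz, rfl⟩
      rw [mem_closedBall_zero_iff]
      exact le_of_tendsto (hpt z hz).norm
        (Eventually.of_forall fun n => (mem_ball_zero_iff.1 ((hF n).2.2.1 hz)).le)
    rw [← interior_closedBall (0 : ℂ) one_ne_zero]
    exact interior_maximal h1 hfo
  have hfF : Fam U f := ⟨hfd, hfi, fun z hz => hfb ⟨z, hz, rfl⟩, hf0⟩
  refine ⟨f, hfF, hfb.antisymm ?_⟩
  intro p hp
  by_contra hpU
  obtain ⟨k', hk', hlt⟩ := fam_improve hU hc h1 h0 hfF (mem_ball_zero_iff.1 hp) hpU hyU hy0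
  have := le_csSup hSb ⟨k', hk', rfl⟩
  linarith

end ArcExt

end

section
open Set Filter Topology Complex

namespace ArcExt

/-- `γ` parametrizes an arc over `[0,1]`, with inverse `e`. -/
structure IsArc (γ : ℝ → ℂ) (e : ℂ → ℝ) : Prop where
  cont : Continuous γ
  econt : ContinuousOn e (γ '' Icc 0 1)
  left_inv : ∀ t ∈ Icc (0 : ℝ) 1, e (γ t) = t

lemma IsArc.isCompact {γ : ℝ → ℂ} {e : ℂ → ℝ} (h : IsArc γ e) : IsCompact (γ '' Icc 0 1) :=
  isCompact_Icc.image h.cont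

lemma IsArc.isConnected {γ : ℝ → ℂ} {e : ℂ → ℝ} (h : IsArc γ e) : IsConnected (γ '' Icc 0 1) :=
  (isConnected_Icc zero_le_one).image γ h.cont.continuousOn

lemma IsArc.preconnected_compl {γ : ℝ → ℂ} {e : ℂ → ℝ} (h : IsArc γ e) :
    IsPreconnected (γ '' Icc 0 1)ᶜ := by
  apply isPreconnected_of_forall_pair
  intro p hp q hq
  obtain ⟨W, hW, hWA, hpW, hqW⟩ := NS_arc h.cont h.econt h.left_inv hp hq
  exact ⟨W, hWA, hpW, hqW, hW⟩

/-- Complement of `C` in the inverted coordinate `1 / (z - b)`. -/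
def Iv (b : ℂ) (C : Set ℂ) : Set ℂ := {y | y = 0 ∨ b + y⁻¹ ∉ C}

lemma isOpen_Iv (b : ℂ) {C : Set ℂ} (hC : IsCompact C) : IsOpen (Iv b C) := by
  rw [isOpen_iff_mem_nhds]
  intro y hy
  by_cases hy0 : y = 0
  · subst hy0
    obtain ⟨R, hR⟩ := hC.isBounded.subset_closedBall b
    have h1 : ∀ᶠ y in 𝓝[≠] (0 : ℂ), R < ‖y⁻¹‖ :=
      (tendsto_norm_cobounded_atTop.comp tendsto_inv₀_nhdsNE_zero).eventually_gt_atTop R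
    rw [eventually_nhdsWithin_iff] at h1
    filter_upwards [h1] with y hy
    by_cases hy0 : y = 0
    · exact Or.inl hy0
    · refine Or.inr fun hyC => ?_
      have := hR hyC
      rw [mem_closedBall_iff_norm, add_sub_cancel_left] at this
      exact absurd (hy hy0) (not_lt.2 this)
  · have h1 : ContinuousAt (fun y : ℂ => b + y⁻¹) y :=
      continuousAt_const.add (continuousAt_inv₀ hy0)
    filter_upwards [h1.eventually_mem (hC.isClosed.isOpen_compl.mem_nhds (hy.resolve_left hy0))]
      with z hz
    exact Or.inr hz

lemma isCompact_Iv {b : ℂ} {N : Set ℂ} (hN : IsOpen N) (hb : b ∈ N) : IsCompact (Iv b N) := by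
  apply Metric.isCompact_of_isClosed_isBounded
  · rw [← isOpen_compl_iff, isOpen_iff_mem_nhds]
    intro y hy
    simp only [Iv, mem_compl_iff, mem_ofPred_eq, not_or, not_not] at hy
    have h1 : ContinuousAt (fun y : ℂ => b + y⁻¹) y :=
      continuousAt_const.add (continuousAt_inv₀ hy.1)
    filter_upwards [h1.eventually_mem (hN.mem_nhds hy.2), isOpen_ne.mem_nhds hy.1] with z hz hz0
    simp only [Iv, mem_compl_iff, mem_ofPred_eq, not_or, not_not]
    exact ⟨hz0, hz⟩
  · obtain ⟨ε, hε, hεN⟩ := Metric.isOpen_iff.1 hN b hb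
    refine (Metric.isBounded_closedBall (x := (0 : ℂ)) (r := ε⁻¹)).subset ?_
    rintro y (rfl | hy)
    · simpa using hε.le
    · rw [mem_closedBall_zero_iff]
      have : ε ≤ ‖y⁻¹‖ := by
        by_contra! hlt
        apply hy
        apply hεN
        rwa [mem_ball_iff_norm, add_sub_cancel_left]
      rw [norm_inv] at this
      exact (le_inv_comm₀ hε (inv_pos.1 (lt_of_lt_of_le hε this))).1 this

lemma isPreconnected_image_inv {b : ℂ} {S : Set ℂ} (hS : IsPreconnected S) (hb : b ∉ S) :
    IsPreconnected ((fun z => (z - b)⁻¹) '' S) := by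
  refine hS.image _ ?_
  refine ContinuousOn.inv₀ (by fun_prop) ?_
  intro z hz h
  rw [sub_eq_zero] at h
  exact hb (h ▸ hz)

lemma IsArc.isConnected_Iv {γ : ℝ → ℂ} {e : ℂ → ℝ} (h : IsArc γ e) {b : ℂ}
    (hb : b ∈ γ '' Icc 0 1) : IsConnected (Iv b (γ '' Icc 0 1)) := by
  refine ⟨⟨0, Or.inl rfl⟩, ?_⟩
  have hs := isPreconnected_image_inv h.preconnected_compl (b := b) (fun hh => hh hb)
  have hmem : ∀ y ∈ Iv b (γ '' Icc 0 1), y ≠ 0 →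
      y ∈ (fun z => (z - b)⁻¹) '' (γ '' Icc 0 1)ᶜ := by
    intro y hy hy0
    exact ⟨b + y⁻¹, hy.resolve_left hy0, by simp⟩
  refine hs.subset_closure ?_ ?_
  · rintro _ ⟨z, hz, rfl⟩
    refine Or.inr ?_
    simpa using hz
  · intro y hy
    by_cases hy0 : y = 0
    · subst hy0
      rw [mem_closure_iff_frequently]
      have h1 : ∀ᶠ y in 𝓝[≠] (0 : ℂ), y ∈ (fun z => (z - b)⁻¹) '' (γ '' Icc 0 1)ᶜ := by
        filter_upwards [mem_nhdsWithin_of_mem_nhds ((isOpen_Iv b h.isCompact).mem_nhds hy),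
          self_mem_nhdsWithin] with y hy hy0
        exact hmem y hy hy0
      exact h1.frequently.filter_mono nhdsWithin_le_nhds
    · exact subset_closure (hmem y hy hy0)

open Pointwise in
lemma preconnected_thickening {A : Set ℂ} (hA : IsPreconnected A) (δ : ℝ) :
    IsPreconnected (Metric.thickening δ A) := by
  rw [← add_ball_zero, ← Set.add_image_prod]
  exact (hA.prod (convex_ball (0 : ℂ) δ).isPreconnected).image _ (by fun_prop)

lemma IsArc.collar {γ : ℝ → ℂ} {e : ℂ → ℝ} (h : IsArc γ e) {δ : ℝ} :
    IsPreconnected (Metric.thickening δ (γ '' Icc 0 1) \ (γ '' Icc 0 1)) := by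
  set A := γ '' Icc 0 1 with hA
  set N := Metric.thickening δ A with hN
  have hNo : IsOpen N := Metric.isOpen_thickening
  obtain ⟨R, hR⟩ := (h.isCompact.isBounded.thickening (δ := δ)).subset_closedBall 0
  apply isPreconnected_of_forall_pair
  intro p hp q hq
  have hK2 : IsCompact (Metric.closedBall (0 : ℂ) R \ N) := (isCompact_closedBall _ _).diff hNo
  have hAN : A ⊆ N := by
    rcases lt_or_ge 0 δ with hδ | hδ
    · exact Metric.self_subset_thickening hδ A
    · have := hp.1
      rw [hN, Metric.thickening_of_nonpos hδ] at this
      exact this.elim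
  have hd : A ∩ (Metric.closedBall (0 : ℂ) R \ N) = ∅ := by
    ext z
    simp only [mem_inter_iff, Set.mem_sdiff, mem_empty_iff_false, iff_false]
    rintro ⟨h1, -, h2⟩
    exact h2 (hAN h1)
  obtain ⟨W, hW, hWA, hpW, hqW⟩ := janiszewski h.isCompact hK2 (by
      rw [hd]; exact isPreconnected_empty) (NS_arc h.cont h.econt h.left_inv hp.2 hq.2)
      ⟨N, preconnected_thickening h.isConnected.isPreconnected δ, fun z hz hz2 => hz2.2 hz,
        hp.1, hq.1⟩
  have hWN : W ⊆ N := by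
    refine IsPreconnected.subset_left_of_subset_union hNo
      (Metric.isClosed_closedBall (x := (0 : ℂ)) (ε := R)).isOpen_compl ?_ ?_ ⟨p, hpW, hp.1⟩ hW
    · rw [Set.disjoint_left]
      intro z hz hz2
      exact hz2 (hR hz)
    · intro z hz
      by_contra hz2
      simp only [mem_union, not_or, mem_compl_iff, not_not] at hz2
      exact hWA hz (Or.inr ⟨hz2.2, hz2.1⟩)
  exact ⟨W, fun z hz => ⟨hWN hz, fun hzA => hWA hz (Or.inl hzA)⟩, hpW, hqW, hW⟩

lemma IsArc.oneEnded {γ : ℝ → ℂ} {e : ℂ → ℝ} (h : IsArc γ e) {b : ℂ}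
    (hb : b ∈ γ '' Icc 0 1) : OneEnded (Iv b (γ '' Icc 0 1)) := by
  intro K hK hKc
  have hT : IsOpen {z | z - b ∈ Iv 0 K} :=
    (isOpen_Iv 0 hKc).preimage (by fun_prop)
  obtain ⟨δ, hδ, hδT⟩ := h.isCompact.exists_thickening_subset_open hT (by
    intro z hz
    by_contra hz2
    simp only [Iv, mem_ofPred_eq, not_or, not_not, zero_add] at hz2
    rcases hK hz2.2 with h1 | h1
    · exact hz2.1 (inv_eq_zero.1 h1)
    · simp only [inv_inv, add_sub_cancel] at h1
      exact h1 hz)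
  have hAN := Metric.self_subset_thickening hδ (γ '' Icc 0 1)
  refine ⟨Iv b (Metric.thickening δ (γ '' Icc 0 1)), isCompact_Iv Metric.isOpen_thickening
    (hAN hb), ?_, ?_, ?_⟩
  · intro y hy
    by_cases hy0 : y = 0
    · exact Or.inl hy0
    · refine Or.inr fun h1 => ?_
      have h2 := hδT h1
      simp only [Iv, mem_ofPred_eq, add_sub_cancel_left, inv_inv, zero_add] at h2
      exact h2.elim (fun h3 => hy0 (inv_eq_zero.1 h3)) (fun h3 => h3 hy)
  · rintro y (hy | hy)
    · exact Or.inl hy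
    · exact Or.inr fun h1 => hy (hAN h1)
  · convert isPreconnected_image_inv (h.collar (δ := δ)) (b := b) (fun hh => hh.2 hb) using 1
    ext y
    constructor
    · rintro ⟨h1, h2⟩
      simp only [Iv, mem_ofPred_eq, not_or, not_not] at h2
      exact ⟨b + y⁻¹, ⟨h2.2, h1.resolve_left h2.1⟩, by simp⟩
    · rintro ⟨z, ⟨h1, h2⟩, rfl⟩
      refine ⟨Or.inr (by simpa using h2), ?_⟩
      simp only [Iv, mem_ofPred_eq, not_or, not_not, inv_inv, add_sub_cancel]
      refine ⟨?_, h1⟩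
      rw [inv_eq_zero, sub_eq_zero]
      rintro rfl
      exact h2 hb

lemma IsArc.exists_fam {γ : ℝ → ℂ} {e : ℂ → ℝ} (h : IsArc γ e) :
    ∃ k, Fam (Iv (γ 1) (γ '' Icc 0 1)) k := by
  set A := γ '' Icc 0 1 with hA
  set b := γ 1 with hb
  set U := Iv b A with hUdef
  have hU : IsOpen U := isOpen_Iv b h.isCompact
  have h0U : (0 : ℂ) ∈ U := Or.inl rfl
  have hab : γ 0 - b ≠ 0 := by
    rw [sub_ne_zero]
    intro hh
    have := congr_arg e hh
    rw [hb, h.left_inv 0 (by simp), h.left_inv 1 (by simp)] at this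
    exact zero_ne_one this
  obtain ⟨L, hL, hLe⟩ : HasLog (fun y => 1 - (γ 0 - b) * y) U := by
    apply hasLog_of_subtype
    obtain ⟨L, hL, hLe⟩ := log_homotopy (X := U)
      (fun p => 1 - (γ (1 - (p.1 : ℝ)) - b) * (p.2 : ℂ)) (by
        have := h.cont
        fun_prop) (by
        rintro ⟨t, y, hy⟩ hh
        simp only at hh
        have hy0 : y ≠ 0 := by
          rintro rfl
          simp at hh
        refine hy.resolve_left hy0 ⟨1 - (t : ℝ), ⟨by linarith [t.2.2], by linarith [t.2.1]⟩, ?_⟩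
        have : y⁻¹ = γ (1 - (t : ℝ)) - b := by
          field_simp
          linear_combination hh
        rw [this]; ring) (by
        intro x
        simp [hb])
    refine ⟨L, hL, fun z => ?_⟩
    rw [hLe]
    simp
  set s : ℂ → ℂ := fun y => exp (L y / 2) with hs
  have hs2 : ∀ y ∈ U, s y ^ 2 = 1 - (γ 0 - b) * y := by
    intro y hy
    have e0 : exp (L y) = 1 - (γ 0 - b) * y := hLe y hy
    rw [← e0]
    simp only [hs]
    rw [← Complex.exp_nat_mul]
    congr 1
    push_cast
    ring
  have hs0 : ∀ y, s y ≠ 0 := fun y => exp_ne_zero _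
  have hsc : ContinuousOn s U := (hL.div_const 2).cexp
  have hsd : DifferentiableOn ℂ s U :=
    holo_sqrt hU hsc (by fun_prop) hs2 (fun y _ => hs0 y)
  have hsq : ∀ y ∈ U, ∀ z ∈ U, s y ^ 2 = s z ^ 2 → y = z := by
    intro y hy z hz hyz
    rw [hs2 y hy, hs2 z hz] at hyz
    have : (γ 0 - b) * y = (γ 0 - b) * z := by linear_combination -hyz
    exact mul_left_cancel₀ hab this
  have hsi : InjOn s U := fun y hy z hz hyz => hsq y hy z hz (by rw [hyz])
  obtain ⟨ε, hε, hεs⟩ := Metric.isOpen_iff.1 (holo_image_open hU hsd hsi) (s 0) ⟨0, h0U, rfl⟩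
  have hfar : ∀ y ∈ U, ε ≤ ‖s y + s 0‖ := by
    intro y hy
    by_contra! hlt
    have : -s y ∈ Metric.ball (s 0) ε := by
      have e1 : -s y - s 0 = -(s y + s 0) := by ring
      rwa [mem_ball_iff_norm, e1, norm_neg]
    obtain ⟨z, hz, hzy⟩ := hεs this
    have h1 : z = y := hsq z hz y hy (by rw [hzy]; ring)
    subst h1
    have : s z = 0 := by linear_combination hzy / 2
    exact hs0 z this
  have hne : ∀ y ∈ U, s y + s 0 ≠ 0 := by
    intro y hy hh
    have := hfar y hy
    rw [hh, norm_zero] at this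
    linarith
  set c : ℝ := (ε⁻¹ + ‖(s 0 + s 0)⁻¹‖ + 1)⁻¹ with hc
  have hcpos : 0 < c := by positivity
  refine ⟨fun y => (c : ℂ) * ((s y + s 0)⁻¹ - (s 0 + s 0)⁻¹), ?_, ?_, ?_, ?_⟩
  · exact (((hsd.add_const _).fun_inv hne).sub_const _).const_mul _
  · intro y hy z hz hyz
    have hc0 : (c : ℂ) ≠ 0 := by exact_mod_cast hcpos.ne'
    have h1 := mul_left_cancel₀ hc0 hyz
    have h2 : (s y + s 0)⁻¹ = (s z + s 0)⁻¹ := by linear_combination h1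
    exact hsi hy hz (add_right_cancel (inv_injective h2))
  · intro y hy
    rw [mem_ball_zero_iff, norm_mul, Complex.norm_real, Real.norm_of_nonneg hcpos.le]
    have h1 : ‖(s y + s 0)⁻¹‖ ≤ ε⁻¹ := by
      rw [norm_inv]
      exact inv_anti₀ hε (hfar y hy)
    have h2 := norm_sub_le (s y + s 0)⁻¹ (s 0 + s 0)⁻¹
    rw [hc, inv_mul_lt_one₀ (by positivity)]
    linarith
  · simp

/-- Uniformization of the complement of an arc. -/
theorem IsArc.uniformize {γ : ℝ → ℂ} {e : ℂ → ℝ} (h : IsArc γ e) :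
    ∃ ψ g : ℂ → ℂ, DifferentiableOn ℂ ψ (Metric.ball 0 1 \ {0}) ∧
      MapsTo ψ (Metric.ball 0 1 \ {0}) (γ '' Icc 0 1)ᶜ ∧
      MapsTo g (γ '' Icc 0 1)ᶜ (Metric.ball 0 1 \ {0}) ∧
      (∀ z ∈ Metric.ball (0 : ℂ) 1 \ {0}, g (ψ z) = z) ∧
      (∀ w ∈ (γ '' Icc 0 1)ᶜ, ψ (g w) = w) ∧
      ContinuousOn g (γ '' Icc 0 1)ᶜ ∧
      Tendsto (fun z => ‖ψ z‖) (𝓝[≠] 0) atTop ∧ Tendsto g (Bornology.cobounded ℂ) (𝓝 0) := by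
  set A := γ '' Icc 0 1 with hA
  set b := γ 1 with hb
  have hbA : b ∈ A := ⟨1, by simp, rfl⟩
  obtain ⟨k0, hk0⟩ := h.exists_fam
  have hU := isOpen_Iv b h.isCompact
  have h0U : (0 : ℂ) ∈ Iv b A := Or.inl rfl
  obtain ⟨f, ⟨hfd, hfi, hfb, hf0⟩, hfs⟩ := riemann hU (h.isConnected_Iv hbA) (h.oneEnded hbA) h0U hk0
  obtain ⟨k, hkd, hk⟩ := holo_inverse hU hfd hfi
  rw [hfs] at hkd
  have hk0' : k 0 = 0 := by
    rw [← hf0, hk 0 h0U, hf0]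
  have hkU : ∀ z ∈ Metric.ball (0 : ℂ) 1, k z ∈ Iv b A ∧ f (k z) = z := by
    intro z hz
    rw [← hfs] at hz
    obtain ⟨y, hy, rfl⟩ := hz
    rw [hk y hy]
    exact ⟨hy, rfl⟩
  have hkne : ∀ z ∈ Metric.ball (0 : ℂ) 1 \ {0}, k z ≠ 0 := by
    intro z hz hh
    have := (hkU z hz.1).2
    rw [hh, hf0] at this
    exact hz.2 this.symm
  have hinv : ∀ w ∈ Aᶜ, (w - b)⁻¹ ∈ Iv b A ∧ (w - b)⁻¹ ≠ 0 := by
    intro w hw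
    refine ⟨Or.inr (by simpa using hw), ?_⟩
    rw [Ne, inv_eq_zero, sub_eq_zero]
    rintro rfl
    exact hw hbA
  refine ⟨fun z => b + (k z)⁻¹, fun w => f (w - b)⁻¹, ?_, ?_, ?_, ?_, ?_, ?_, ?_, ?_⟩
  · exact ((hkd.mono sdiff_subset).fun_inv hkne).const_add _
  · intro z hz
    exact (hkU z hz.1).1.resolve_left (hkne z hz)
  · intro w hw
    refine ⟨hfb (hinv w hw).1, fun hh => (hinv w hw).2 (hfi (hinv w hw).1 h0U ?_)⟩
    rw [hf0]; exact hh
  · intro z hz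
    simp only [add_sub_cancel_left, inv_inv]
    exact (hkU z hz.1).2
  · intro w hw
    simp only
    rw [hk _ (hinv w hw).1]
    simp
  · refine hfd.continuousOn.comp ?_ (fun w hw => (hinv w hw).1)
    refine ContinuousOn.inv₀ (by fun_prop) ?_
    intro w hw hh
    exact hw (sub_eq_zero.1 hh ▸ hbA)
  · have h1 : Tendsto k (𝓝[≠] 0) (𝓝[≠] 0) := by
      refine tendsto_nhdsWithin_iff.2 ⟨?_, ?_⟩
      · have : ContinuousAt k 0 := hkd.continuousOn.continuousAt (Metric.ball_mem_nhds 0 one_pos)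
        rw [ContinuousAt, hk0'] at this
        exact this.mono_left nhdsWithin_le_nhds
      · filter_upwards [mem_nhdsWithin_of_mem_nhds (Metric.ball_mem_nhds (0 : ℂ) one_pos),
          self_mem_nhdsWithin] with z hz hz0
        exact hkne z ⟨hz, hz0⟩
    have h2 := tendsto_norm_cobounded_atTop.comp (tendsto_inv₀_nhdsNE_zero.comp h1)
    refine tendsto_atTop_mono ?_ (tendsto_atTop_add_const_right _ (-‖b‖) h2)
    intro z
    have := norm_sub_le (b + (k z)⁻¹) b
    simp only [add_sub_cancel_left] at this
    simp only [Function.comp_apply]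
    linarith
  · have h1 : Tendsto (fun w : ℂ => (w - b)⁻¹) (Bornology.cobounded ℂ) (𝓝 0) :=
      tendsto_inv₀_cobounded.comp (tendsto_sub_const_cobounded b)
    have h2 : ContinuousAt f 0 := hfd.continuousOn.continuousAt (hU.mem_nhds h0U)
    rw [ContinuousAt, hf0] at h2
    exact h2.comp h1

end ArcExt

end

section
open Set Filter Topology Complex MeasureTheory
open scoped ENNReal

namespace ArcExt

lemma area_formula {D : Set ℂ} (hD : IsOpen D) {f : ℂ → ℂ} (hd : DifferentiableOn ℂ f D)
    (hi : InjOn f D) :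
    ∫⁻ z in D, ENNReal.ofReal (‖deriv f z‖ ^ 2) = volume (f '' D) := by
  rw [← lintegral_abs_det_fderiv_eq_addHaar_image volume hD.measurableSet
    (f' := fun z => (ContinuousLinearMap.toSpanSingleton ℂ (deriv f z)).restrictScalars ℝ) ?_ hi]
  · refine lintegral_congr fun z => ?_
    congr 1
    simp [ContinuousLinearMap.det, LinearMap.det_restrictScalars, Algebra.norm_complex_apply,
      Complex.normSq_eq_norm_sq]
  · intro z hz
    exact ((hd.differentiableAt (hD.mem_nhds hz)).hasDerivAt.hasFDerivAt.restrictScalars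
      ℝ).hasFDerivWithinAt

lemma lintegral_polar_one (Φ : ℂ → ℝ≥0∞) (hΦ : Measurable Φ) :
    ∫⁻ r in Ioi (0 : ℝ), ∫⁻ θ in Ioo (-Real.pi) Real.pi,
      ENNReal.ofReal r * Φ (1 - r * exp (θ * I)) = ∫⁻ z, Φ z := by
  have h1 : ∫⁻ z, Φ z = ∫⁻ z, Φ (1 - z) := (lintegral_sub_left_eq_self Φ 1).symm
  have h2 : ∀ p : ℝ × ℝ, Complex.polarCoord.symm p = p.1 * exp (p.2 * I) := by
    intro p
    rw [Complex.polarCoord_symm_apply, Complex.exp_mul_I]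
    push_cast
    ring
  rw [h1, ← Complex.lintegral_comp_polarCoord_symm (fun z => Φ (1 - z)), polarCoord_target]
  rw [Measure.volume_eq_prod, setLIntegral_prod]
  · simp only [h2, smul_eq_mul]
  · simp only [h2, smul_eq_mul]
    refine Measurable.aemeasurable ?_
    refine Measurable.mul (by fun_prop) (hΦ.comp ?_)
    exact Continuous.measurable (by fun_prop)

lemma cos_between {r α β θ : ℝ} (hα : |α| < Real.pi) (hβ : |β| < Real.pi)
    (h1 : r < Real.cos α) (h2 : r < Real.cos β) (hθ : θ ∈ Icc α β) : r < Real.cos θ := by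
  rw [← Real.cos_abs] at h1 h2 ⊢
  rcases le_max_iff.1 (abs_le_max_abs_abs hθ.1 hθ.2) with h | h
  · exact lt_of_lt_of_le h1 (Real.cos_le_cos_of_nonneg_of_le_pi (abs_nonneg _) hα.le h)
  · exact lt_of_lt_of_le h2 (Real.cos_le_cos_of_nonneg_of_le_pi (abs_nonneg _) hβ.le h)

lemma norm_lt_one_polar {r θ : ℝ} (hr : 0 < r) :
    ‖(1 : ℂ) - r * exp (θ * I)‖ < 1 ↔ r / 2 < Real.cos θ := by
  have h1 : ‖(1 : ℂ) - r * exp (θ * I)‖ ^ 2 = 1 + r * (r - 2 * Real.cos θ) := by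
    rw [Complex.sq_norm, Complex.normSq_apply]
    simp only [sub_re, sub_im, mul_re, mul_im, one_re, one_im, ofReal_re, ofReal_im,
      exp_ofReal_mul_I_re, exp_ofReal_mul_I_im]
    have := Real.sin_sq_add_cos_sq θ
    linear_combination r ^ 2 * this
  have h2 := norm_nonneg ((1 : ℂ) - r * exp (θ * I))
  constructor
  · intro h
    have : ‖(1 : ℂ) - r * exp (θ * I)‖ ^ 2 < 1 := by nlinarith
    rw [h1] at this
    have : r * (r - 2 * Real.cos θ) < 0 := by linarith
    by_contra! hge
    have := mul_nonneg hr.le (show 0 ≤ r - 2 * Real.cos θ by linarith)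
    linarith
  · intro h
    have : r * (r - 2 * Real.cos θ) < 0 := mul_neg_of_pos_of_neg hr (by linarith)
    nlinarith

lemma exists_polar_one {r : ℝ} (hr : 0 < r) {z : ℂ} (h1 : ‖z‖ < 1) (h2 : ‖z - 1‖ = r) :
    ∃ θ : ℝ, |θ| < Real.pi ∧ z = 1 - r * exp (θ * I) ∧ r / 2 < Real.cos θ := by
  have e : z = 1 - r * exp (arg (1 - z) * I) := by
    have := norm_mul_exp_arg_mul_I (1 - z)
    rw [norm_sub_rev, h2] at this
    rw [this]; ring
  have hc : r / 2 < Real.cos (arg (1 - z)) := by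
    rw [e] at h1
    exact (norm_lt_one_polar hr).1 h1
  refine ⟨arg (1 - z), lt_of_le_of_ne (abs_arg_le_pi _) ?_, e, hc⟩
  intro h
  rw [← Real.cos_abs, h, Real.cos_pi] at hc
  linarith

/-- A crosscut with large oscillation costs area. -/
lemma crosscut_bound {f : ℂ → ℂ} {δ : ℝ}
    (hd : DifferentiableOn ℂ f (Metric.ball 0 1 ∩ Metric.ball 1 δ)) {r ε : ℝ} (hr : 0 < r)
    (hrδ : r < δ) (hε : 0 < ε) {α β : ℝ} (hα : |α| < Real.pi) (hβ : |β| < Real.pi)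
    (h1 : r / 2 < Real.cos α) (h2 : r / 2 < Real.cos β) (hαβ : α ≤ β)
    (hdist : ε ≤ ‖f (1 - r * exp (β * I)) - f (1 - r * exp (α * I))‖) :
    ENNReal.ofReal (ε ^ 2 / (2 * Real.pi) / r ^ 2) ≤
      ∫⁻ θ in Ioo (-Real.pi) Real.pi, (Metric.ball 0 1 ∩ Metric.ball 1 δ).indicator
        (fun z => ENNReal.ofReal (‖deriv f z‖ ^ 2)) (1 - r * exp (θ * I)) := by
  set D : Set ℂ := Metric.ball 0 1 ∩ Metric.ball 1 δ with hD
  have hDo : IsOpen D := Metric.isOpen_ball.inter Metric.isOpen_ball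
  set c : ℝ → ℂ := fun θ => 1 - r * exp (θ * I) with hc
  have hcD : ∀ θ ∈ Icc α β, c θ ∈ D := by
    intro θ hθ
    refine ⟨?_, ?_⟩
    · rw [mem_ball_zero_iff]
      exact (norm_lt_one_polar hr).2 (cos_between hα hβ h1 h2 hθ)
    · rw [mem_ball_iff_norm]
      simp only [hc, sub_sub_cancel_left, norm_neg, norm_mul, norm_real, norm_exp_ofReal_mul_I,
        mul_one, Real.norm_of_nonneg hr.le]
      exact hrδ
  have hcd : ∀ θ : ℝ, HasDerivAt c (-(r * (exp (θ * I) * I))) θ := by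
    intro θ
    have e1 : HasDerivAt (fun x : ℂ => x * I) I (θ : ℂ) := by
      simpa using (hasDerivAt_id (θ : ℂ)).mul_const I
    have e2 := (e1.cexp.const_mul (r : ℂ)).const_sub 1
    exact e2.comp_ofReal
  have hcc : Continuous c := by fun_prop
  have hf'c : ContinuousOn (fun θ => deriv f (c θ)) (Icc α β) :=
    (hd.deriv hDo).continuousOn.comp hcc.continuousOn hcD
  have hgd : ∀ θ ∈ uIcc α β, HasDerivAt (fun θ => f (c θ))
      (-(r * (exp (θ * I) * I)) * deriv f (c θ)) θ := by
    intro θ hθ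
    rw [uIcc_of_le hαβ] at hθ
    have := (hd.differentiableAt (hDo.mem_nhds (hcD θ hθ))).hasDerivAt.scomp θ (hcd θ)
    rw [smul_eq_mul] at this
    exact this
  have hgc : ContinuousOn (fun θ : ℝ => -(r * (exp (θ * I) * I)) * deriv f (c θ)) (Icc α β) :=
    ContinuousOn.mul (by fun_prop) hf'c
  have h_itg := intervalIntegral.integral_eq_sub_of_hasDerivAt hgd
    (hgc.intervalIntegrable_of_Icc hαβ)
  set J := ∫ θ in α..β, ‖deriv f (c θ)‖ ^ 2 with hJ
  have hJc : ContinuousOn (fun θ => ‖deriv f (c θ)‖ ^ 2) (Icc α β) := hf'c.norm.pow 2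
  have hpi := Real.pi_pos
  have hb : ε ≤ (Real.pi / ε) * r ^ 2 * J + ε / 2 := by
    calc ε ≤ ‖∫ θ in α..β, -(r * (exp (θ * I) * I)) * deriv f (c θ)‖ := by
          rw [h_itg]; exact hdist
      _ ≤ ∫ θ in α..β, ‖-(r * (exp (θ * I) * I)) * deriv f (c θ)‖ :=
          intervalIntegral.norm_integral_le_integral_norm hαβ
      _ ≤ ∫ θ in α..β, ((Real.pi / ε * r ^ 2) * ‖deriv f (c θ)‖ ^ 2 + ε / (4 * Real.pi)) := by
          refine intervalIntegral.integral_mono_on hαβ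
            (hgc.norm.intervalIntegrable_of_Icc hαβ)
            (((hJc.const_mul _).add continuousOn_const).intervalIntegrable_of_Icc hαβ) ?_
          intro θ hθ
          rw [norm_mul, norm_neg, norm_mul, norm_mul, norm_exp_ofReal_mul_I, norm_I, norm_real,
            Real.norm_of_nonneg hr.le]
          set x := ‖deriv f (c θ)‖
          have : Real.pi / ε * r ^ 2 * x ^ 2 + ε / (4 * Real.pi) - r * (1 * 1) * x =
              Real.pi / ε * (r * x - ε / (2 * Real.pi)) ^ 2 := by
            field_simp
            ring
          have h3 : 0 ≤ Real.pi / ε * (r * x - ε / (2 * Real.pi)) ^ 2 := by positivity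
          linarith
      _ = (Real.pi / ε) * r ^ 2 * J + (β - α) * (ε / (4 * Real.pi)) := by
          rw [intervalIntegral.integral_add ((hJc.const_mul _).intervalIntegrable_of_Icc hαβ)
            (by simp), intervalIntegral.integral_const_mul, intervalIntegral.integral_const,
            smul_eq_mul]
      _ ≤ (Real.pi / ε) * r ^ 2 * J + ε / 2 := by
          have h3 : β - α ≤ 2 * Real.pi := by
            linarith [(abs_lt.1 hα).1, (abs_lt.1 hβ).2]
          have h4 : (β - α) * (ε / (4 * Real.pi)) ≤ 2 * Real.pi * (ε / (4 * Real.pi)) := by gcongr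
          have h5 : 2 * Real.pi * (ε / (4 * Real.pi)) = ε / 2 := by field_simp; norm_num
          linarith
  have hJl : ε ^ 2 / (2 * Real.pi) / r ^ 2 ≤ J := by
    rw [div_div, div_le_iff₀ (by positivity)]
    have h3 : ε / 2 ≤ (Real.pi / ε) * r ^ 2 * J := by linarith
    have h4 : (Real.pi / ε) * r ^ 2 * J = Real.pi * r ^ 2 * J / ε := by ring
    rw [h4, le_div_iff₀ hε] at h3
    nlinarith
  refine (ENNReal.ofReal_le_ofReal hJl).trans ?_
  rw [hJ, intervalIntegral.integral_of_le hαβ, ofReal_integral_eq_lintegral_ofReal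
    ((hJc.integrableOn_Icc).mono_set Ioc_subset_Icc_self)
    (Eventually.of_forall fun θ => by positivity)]
  have hsub : Ioc α β ⊆ Ioo (-Real.pi) Real.pi := fun θ hθ =>
    ⟨(abs_lt.1 hα).1.trans hθ.1, hθ.2.trans_lt (abs_lt.1 hβ).2⟩
  refine le_trans (le_of_eq ?_) (lintegral_mono_set hsub)
  refine setLIntegral_congr_fun measurableSet_Ioc ?_
  intro θ hθ
  have : c θ ∈ D := hcD θ (Ioc_subset_Icc_self hθ)
  simp only
  rw [indicator_of_mem (show 1 - (r : ℂ) * exp (θ * I) ∈ D from this)]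

/-- The length-area principle. -/
theorem length_area {f : ℂ → ℂ} {δ : ℝ} (hδ : 0 < δ)
    (hd : DifferentiableOn ℂ f (Metric.ball 0 1 ∩ Metric.ball 1 δ))
    (hi : InjOn f (Metric.ball 0 1 ∩ Metric.ball 1 δ)) {M : ℝ}
    (hb : ∀ z ∈ Metric.ball 0 1 ∩ Metric.ball 1 δ, ‖f z‖ ≤ M) {ε : ℝ} (hε : 0 < ε) :
    ∃ r, 0 < r ∧ r < δ ∧ ∀ z w : ℂ, ‖z‖ < 1 → ‖w‖ < 1 → ‖z - 1‖ = r → ‖w - 1‖ = r →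
      ‖f z - f w‖ < ε := by
  by_contra! hcon
  set D : Set ℂ := Metric.ball 0 1 ∩ Metric.ball 1 δ with hD
  have hDo : IsOpen D := Metric.isOpen_ball.inter Metric.isOpen_ball
  set Φ : ℂ → ℝ≥0∞ := D.indicator (fun z => ENNReal.ofReal (‖deriv f z‖ ^ 2)) with hΦ
  have hΦm : Measurable Φ := by
    refine Measurable.indicator ?_ hDo.measurableSet
    have := measurable_deriv f
    fun_prop
  have hfin : ∫⁻ z, Φ z < ⊤ := by
    rw [hΦ, lintegral_indicator hDo.measurableSet, area_formula hDo hd hi]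
    refine lt_of_le_of_lt (measure_mono ?_) (measure_closedBall_lt_top (x := (0 : ℂ)) (r := M))
    rintro _ ⟨z, hz, rfl⟩
    simpa using hb z hz
  rw [← lintegral_polar_one Φ hΦm] at hfin
  have key : ∀ r ∈ Ioo 0 δ, ENNReal.ofReal (ε ^ 2 / (2 * Real.pi) * r⁻¹) ≤
      ∫⁻ θ in Ioo (-Real.pi) Real.pi, ENNReal.ofReal r * Φ (1 - r * exp (θ * I)) := by
    rintro r ⟨hr, hrδ⟩
    have hm : Measurable (fun θ : ℝ => Φ (1 - r * exp (θ * I))) :=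
      hΦm.comp (Continuous.measurable (by fun_prop))
    rw [lintegral_const_mul _ hm]
    have hk : ENNReal.ofReal (ε ^ 2 / (2 * Real.pi) / r ^ 2) ≤
        ∫⁻ θ in Ioo (-Real.pi) Real.pi, Φ (1 - r * exp (θ * I)) := by
      obtain ⟨z, w, hz, hw, hzr, hwr, hzw⟩ := hcon r hr hrδ
      obtain ⟨α, hα1, hα2, hα3⟩ := exists_polar_one hr hz hzr
      obtain ⟨β, hβ1, hβ2, hβ3⟩ := exists_polar_one hr hw hwr
      rcases le_total α β with hαβ | hαβ
      · refine crosscut_bound hd hr hrδ hε hα1 hβ1 hα3 hβ3 hαβ ?_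
        rw [← hα2, ← hβ2, norm_sub_rev]
        exact hzw
      · refine crosscut_bound hd hr hrδ hε hβ1 hα1 hβ3 hα3 hαβ ?_
        rw [← hα2, ← hβ2]
        exact hzw
    have h3 : ε ^ 2 / (2 * Real.pi) * r⁻¹ = r * (ε ^ 2 / (2 * Real.pi) / r ^ 2) := by
      field_simp
    rw [h3, ENNReal.ofReal_mul hr.le]
    gcongr
  have hfin2 : ∫⁻ r in Ioo 0 δ, ENNReal.ofReal (ε ^ 2 / (2 * Real.pi) * r⁻¹) < ⊤ := by
    refine lt_of_le_of_lt ?_ hfin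
    refine le_trans (setLIntegral_mono' measurableSet_Ioo key) ?_
    exact lintegral_mono_set Ioo_subset_Ioi_self
  have h_itg : IntegrableOn (fun r : ℝ => ε ^ 2 / (2 * Real.pi) * r⁻¹) (Ioo 0 δ) := by
    refine ⟨(Measurable.aestronglyMeasurable (by fun_prop)), ?_⟩
    rw [hasFiniteIntegral_iff_ofReal]
    · exact hfin2
    · refine (ae_restrict_iff' measurableSet_Ioo).2 (Eventually.of_forall fun r hr => ?_)
      have := hr.1
      have := Real.pi_pos
      simp only [Pi.zero_apply]
      positivity
  have hpi := Real.pi_pos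
  have h_itg2 : IntegrableOn (fun r : ℝ => r⁻¹) (Ioo 0 δ) := by
    refine (h_itg.const_mul (ε ^ 2 / (2 * Real.pi))⁻¹).congr ?_
    refine Eventually.of_forall fun r => ?_
    simp only
    field_simp
  have : IntervalIntegrable (fun r : ℝ => r⁻¹) volume 0 δ := by
    rw [intervalIntegrable_iff_integrableOn_Ioo_of_le hδ.le]
    exact h_itg2
  rw [intervalIntegrable_inv_iff] at this
  rcases this with h | h
  · exact hδ.ne h
  · exact h left_mem_uIcc

end ArcExt

end

section
open Set Filter Topology Complex

namespace ArcExt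

/-- Punctured open disc. -/
def PD : Set ℂ := Metric.ball 0 1 \ {0}

/-- Punctured closed disc. -/
def PX : Set ℂ := Metric.closedBall 0 1 \ {0}

lemma isOpen_PD : IsOpen PD := Metric.isOpen_ball.sdiff isClosed_singleton

lemma PD_subset_PX : PD ⊆ PX := sdiff_subset_sdiff_left Metric.ball_subset_closedBall

lemma mem_PD {z : ℂ} : z ∈ PD ↔ ‖z‖ < 1 ∧ z ≠ 0 := by simp [PD]

lemma mem_PX {z : ℂ} : z ∈ PX ↔ ‖z‖ ≤ 1 ∧ z ≠ 0 := by simp [PX]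

/-- Uniformization of the complement of an arc. -/
structure Unif (γ : ℝ → ℂ) (e : ℂ → ℝ) (ψ g : ℂ → ℂ) : Prop where
  arc : IsArc γ e
  diff : DifferentiableOn ℂ ψ PD
  maps : MapsTo ψ PD (γ '' Icc 0 1)ᶜ
  gmaps : MapsTo g (γ '' Icc 0 1)ᶜ PD
  gψ : ∀ z ∈ PD, g (ψ z) = z
  ψg : ∀ w ∈ (γ '' Icc 0 1)ᶜ, ψ (g w) = w
  gcont : ContinuousOn g (γ '' Icc 0 1)ᶜ
  top : Tendsto (fun z => ‖ψ z‖) (𝓝[≠] 0) atTop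
  gtop : Tendsto g (Bornology.cobounded ℂ) (𝓝 0)

lemma IsArc.exists_unif {γ : ℝ → ℂ} {e : ℂ → ℝ} (h : IsArc γ e) : ∃ ψ g, Unif γ e ψ g := by
  obtain ⟨ψ, g, h1, h2, h3, h4, h5, h6, h7, h8⟩ := h.uniformize
  exact ⟨ψ, g, h, h1, h2, h3, h4, h5, h6, h7, h8⟩

section
variable {γ : ℝ → ℂ} {e : ℂ → ℝ} {ψ g : ℂ → ℂ}

lemma Unif.injOn (u : Unif γ e ψ g) : InjOn ψ PD := fun x hx y hy hxy => by
  rw [← u.gψ x hx, hxy, u.gψ y hy]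

lemma Unif.bdd (u : Unif γ e ψ g) : ∃ M, ∀ z ∈ PD, 1 / 2 ≤ ‖z‖ → ‖ψ z‖ ≤ M := by
  have h1 : ∀ᶠ w in Bornology.cobounded ℂ, ‖g w‖ < 1 / 2 := by
    have := u.gtop.norm
    rw [norm_zero] at this
    exact this.eventually_lt_const (by norm_num)
  rw [← comap_norm_atTop, eventually_comap] at h1
  obtain ⟨M, hM⟩ := eventually_atTop.1 h1
  refine ⟨M, fun z hz hz2 => ?_⟩
  by_contra! hlt
  have := hM ‖ψ z‖ hlt.le (ψ z) rfl
  rw [u.gψ z hz] at this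
  linarith

lemma Unif.crosscut (u : Unif γ e ψ g) {ζ : ℂ} (hζ : ‖ζ‖ = 1) {δ : ℝ} (hδ : 0 < δ)
    (hδ2 : δ ≤ 1 / 2) {ε : ℝ} (hε : 0 < ε) :
    ∃ r, 0 < r ∧ r < δ ∧ ∀ z w : ℂ, ‖z‖ < 1 → ‖w‖ < 1 → ‖z - ζ‖ = r → ‖w - ζ‖ = r →
      ‖ψ z - ψ w‖ < ε := by
  obtain ⟨M, hM⟩ := u.bdd
  have hζ0 : ζ ≠ 0 := by
    rintro rfl
    simp at hζ
  have hhalf : ∀ z ∈ Metric.ball (1 : ℂ) δ, 1 / 2 ≤ ‖z‖ := by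
    intro z hz
    rw [mem_ball_iff_norm] at hz
    have := norm_sub_norm_le (1 : ℂ) z
    rw [norm_one, norm_sub_rev] at this
    linarith
  have hm : MapsTo (fun z => ζ * z) (Metric.ball 0 1 ∩ Metric.ball 1 δ) PD := by
    intro z hz
    rw [mem_PD, norm_mul, hζ, one_mul]
    refine ⟨by simpa using hz.1, mul_ne_zero hζ0 ?_⟩
    rintro rfl
    have := hhalf 0 hz.2
    norm_num at this
  obtain ⟨r, hr, hrδ, hr2⟩ := length_area (f := fun z => ψ (ζ * z)) hδ
    (u.diff.comp (by fun_prop) hm)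
    (fun x hx y hy hxy => mul_left_cancel₀ hζ0 (u.injOn (hm hx) (hm hy) hxy))
    (M := M) (fun z hz => hM _ (hm hz) (by rw [norm_mul, hζ, one_mul]; exact hhalf z hz.2)) hε
  refine ⟨r, hr, hrδ, fun z w hz hw hzr hwr => ?_⟩
  have hn : ∀ z, ‖z - ζ‖ = r → ‖ζ⁻¹ * z - 1‖ = r := by
    intro z hz
    have : ζ⁻¹ * z - 1 = ζ⁻¹ * (z - ζ) := by field_simp
    rw [this, norm_mul, norm_inv, hζ, inv_one, one_mul, hz]
  have := hr2 (ζ⁻¹ * z) (ζ⁻¹ * w) (by rw [norm_mul, norm_inv, hζ, inv_one, one_mul]; exact hz)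
    (by rw [norm_mul, norm_inv, hζ, inv_one, one_mul]; exact hw) (hn z hzr) (hn w hwr)
  simpa [mul_inv_cancel_left₀ hζ0] using this

/-- A small set meets the arc inside a small subarc. -/
lemma IsArc.small_subarc (h : IsArc γ e) {ρ : ℝ} (hρ : 0 < ρ) : ∃ ε > 0, ∀ (C : Set ℂ) (w : ℂ),
    C ⊆ Metric.closedBall w ε → ∃ (x : ℂ) (A' : Set ℂ), IsCompact A' ∧ IsPreconnected A' ∧
      A' ⊆ γ '' Icc 0 1 ∧ C ∩ γ '' Icc 0 1 ⊆ A' ∧ C ∪ A' ⊆ Metric.ball x ρ := by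
  have hγu := isCompact_Icc.uniformContinuousOn_of_continuous (h.cont.continuousOn (s := Icc 0 1))
  have heu := h.isCompact.uniformContinuousOn_of_continuous h.econt
  rw [Metric.uniformContinuousOn_iff] at hγu heu
  obtain ⟨κ, hκ, hγκ⟩ := hγu ρ hρ
  obtain ⟨ε, hε, heε⟩ := heu (κ / 2) (by positivity)
  refine ⟨min (ε / 3) (ρ / 3), by positivity, fun C w hC => ?_⟩
  by_cases hne : (C ∩ γ '' Icc 0 1).Nonempty
  · obtain ⟨x, hxC, t, ht, rfl⟩ := hne
    have hdist : ∀ y ∈ C, dist y (γ t) < ε ∧ dist y (γ t) < ρ := by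
      intro y hy
      have h1 := hC hy
      have h2 := hC hxC
      rw [Metric.mem_closedBall] at h1 h2
      have h3 := dist_triangle_right y (γ t) w
      have h4 := min_le_left (ε / 3) (ρ / 3)
      have h5 := min_le_right (ε / 3) (ρ / 3)
      constructor <;> linarith
    refine ⟨γ t, γ '' (Icc (max 0 (t - κ / 2)) (min 1 (t + κ / 2))), isCompact_Icc.image h.cont,
      isPreconnected_Icc.image γ h.cont.continuousOn, image_mono ?_, ?_, ?_⟩
    · exact Icc_subset_Icc (le_max_left _ _) (min_le_left _ _)
    · rintro _ ⟨hy, s, hs, rfl⟩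
      have := heε _ ⟨s, hs, rfl⟩ _ ⟨t, ht, rfl⟩ (hdist _ hy).1
      rw [h.left_inv s hs, h.left_inv t ht, Real.dist_eq, abs_lt] at this
      exact ⟨s, ⟨max_le hs.1 (by linarith), le_min hs.2 (by linarith)⟩, rfl⟩
    · rintro y (hy | ⟨s, hs, rfl⟩)
      · exact (hdist y hy).2
      · have h1 := (max_le_iff.1 hs.1)
        have h2 := (le_min_iff.1 hs.2)
        apply hγκ s ⟨h1.1, h2.1⟩ t ht
        rw [Real.dist_eq, abs_lt]
        constructor <;> linarith
  · rw [not_nonempty_iff_eq_empty] at hne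
    refine ⟨w, ∅, isCompact_empty, isPreconnected_empty, empty_subset _, hne.subset, ?_⟩
    rw [union_empty]
    refine hC.trans (Metric.closedBall_subset_ball ?_)
    have h5 := min_le_right (ε / 3) (ρ / 3)
    linarith

lemma Unif.small_cap (u : Unif γ e ψ g) {ζ : ℂ} (hζ : ‖ζ‖ = 1) {ρ : ℝ} (hρ : 0 < ρ) :
    ∃ r > 0, ∃ x, ∀ z ∈ PD, ‖z - ζ‖ < r → ψ z ∈ Metric.ball x ρ := by
  obtain ⟨ε, hε, hsub⟩ := u.arc.small_subarc hρ
  obtain ⟨r, hr, hrδ, hcut⟩ := u.crosscut hζ (δ := 1 / 2) (by norm_num) le_rfl hε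
  set c : Set ℂ := {z | ‖z‖ < 1 ∧ ‖z - ζ‖ = r} with hc
  set C := closure (ψ '' c) with hC
  have hz0 : ((1 - r : ℝ) : ℂ) * ζ ∈ c := by
    constructor
    · rw [norm_mul, hζ, norm_real, Real.norm_of_nonneg (by linarith)]
      linarith
    · have : ((1 - r : ℝ) : ℂ) * ζ - ζ = -((r : ℂ) * ζ) := by push_cast; ring
      rw [this, norm_neg, norm_mul, hζ, norm_real, Real.norm_of_nonneg hr.le, mul_one]
  set w0 := ψ (((1 - r : ℝ) : ℂ) * ζ) with hw0
  have hCb : C ⊆ Metric.closedBall w0 ε := by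
    refine closure_minimal ?_ Metric.isClosed_closedBall
    rintro _ ⟨z, hz, rfl⟩
    rw [mem_closedBall_iff_norm]
    exact (hcut _ _ hz.1 hz0.1 hz.2 hz0.2).le
  obtain ⟨x, A', hA'c, hA'p, hA'A, hCA, hball⟩ := hsub C w0 hCb
  refine ⟨r, hr, x, fun z₁ hz₁ hz₁r => ?_⟩
  by_contra hout
  have hCc : IsCompact C := (isCompact_closedBall w0 ε).of_isClosed_subset isClosed_closure hCb
  -- a point near `0`
  obtain ⟨z₂, hz₂, hz₂n, hz₂b⟩ : ∃ z ∈ PD, ‖z‖ < 1 / 2 ∧ ψ z ∉ Metric.ball x ρ := by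
    have h1 := u.top.eventually_gt_atTop (‖x‖ + ρ)
    have h2 : ∀ᶠ z in 𝓝[≠] (0 : ℂ), ‖z‖ < 1 / 2 := by
      filter_upwards [mem_nhdsWithin_of_mem_nhds (Metric.ball_mem_nhds (0 : ℂ)
        (show (0 : ℝ) < 1 / 2 by norm_num))] with z hz
      simpa using hz
    obtain ⟨z, h3, h4, h5⟩ := (h1.and (h2.and eventually_mem_nhdsWithin)).exists
    refine ⟨z, mem_PD.2 ⟨by linarith, h5⟩, h4, fun h6 => ?_⟩
    rw [mem_ball_iff_norm] at h6
    have := norm_sub_norm_le (ψ z) x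
    linarith
  have hz₂r : r < ‖z₂ - ζ‖ := by
    have := norm_sub_norm_le ζ z₂
    rw [hζ, norm_sub_rev] at this
    linarith
  have hinter : γ '' Icc 0 1 ∩ (C ∪ A') = A' := by
    apply Subset.antisymm
    · rintro y ⟨h1, h2 | h2⟩
      · exact hCA ⟨h2, h1⟩
      · exact h2
    · exact fun y hy => ⟨hA'A hy, Or.inr hy⟩
  obtain ⟨W, hW, hWs, hW1, hW2⟩ := janiszewski u.arc.isCompact (hCc.union hA'c)
    (by rw [hinter]; exact hA'p) (NS_arc u.arc.cont u.arc.econt u.arc.left_inv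
      (u.maps hz₁) (u.maps hz₂))
    ⟨(Metric.ball x ρ)ᶜ, isPreconnected_compl_ball x ρ hρ.le, compl_subset_compl.2 hball,
      hout, hz₂b⟩
  have hWA : W ⊆ (γ '' Icc 0 1)ᶜ := fun w hw hwA => hWs hw (Or.inl hwA)
  have hcont : ContinuousOn (fun w => ‖g w - ζ‖) W :=
    ((u.gcont.mono hWA).sub continuousOn_const).norm
  have hmem : r ∈ Icc (‖g (ψ z₁) - ζ‖) (‖g (ψ z₂) - ζ‖) := by
    rw [u.gψ z₁ hz₁, u.gψ z₂ hz₂]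
    exact ⟨hz₁r.le, hz₂r.le⟩
  obtain ⟨w, hw, hwr⟩ := hW.intermediate_value hW1 hW2 hcont hmem
  refine hWs hw (Or.inr (Or.inl (subset_closure ⟨g w, ⟨?_, hwr⟩, u.ψg w (hWA hw)⟩)))
  exact (mem_PD.1 (u.gmaps (hWA hw))).1

lemma PX_subset_closure : PX ⊆ closure PD := by
  intro z hz
  rw [mem_PX] at hz
  have h1 : Tendsto (fun t : ℝ => (t : ℂ) * z) (𝓝[<] 1) (𝓝 z) := by
    have : Continuous (fun t : ℝ => (t : ℂ) * z) := by fun_prop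
    have := this.tendsto 1
    simp only [ofReal_one, one_mul] at this
    exact this.mono_left nhdsWithin_le_nhds
  refine mem_closure_of_tendsto h1 ?_
  have h2 : ∀ᶠ t in 𝓝[<] (1 : ℝ), 0 < t :=
    mem_nhdsWithin_of_mem_nhds (isOpen_Ioi.mem_nhds (by simp))
  filter_upwards [h2, self_mem_nhdsWithin] with t ht ht1
  have ht1 : t < 1 := ht1
  refine mem_PD.2 ⟨?_, mul_ne_zero (by exact_mod_cast ht.ne') hz.2⟩
  rw [norm_mul, norm_real, Real.norm_of_nonneg ht.le]
  have : 0 < ‖z‖ := norm_pos_iff.2 hz.2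
  nlinarith

lemma Unif.exists_lim (u : Unif γ e ψ g) {ζ : ℂ} (hζ : ζ ∈ PX) :
    ∃ x, Tendsto ψ (𝓝[PD] ζ) (𝓝 x) := by
  by_cases h1 : ‖ζ‖ = 1
  · have : (𝓝[PD] ζ).NeBot := mem_closure_iff_nhdsWithin_neBot.1 (PX_subset_closure hζ)
    rw [← cauchy_map_iff_exists_tendsto, Metric.cauchy_iff]
    refine ⟨inferInstance, fun ε hε => ?_⟩
    obtain ⟨r, hr, x, hx⟩ := u.small_cap h1 (half_pos hε)
    refine ⟨Metric.ball x (ε / 2), ?_, fun y hy z hz => ?_⟩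
    · rw [mem_map]
      filter_upwards [mem_nhdsWithin_of_mem_nhds (Metric.ball_mem_nhds ζ hr), self_mem_nhdsWithin]
        with z hz hzP
      exact hx z hzP (mem_ball_iff_norm.1 hz)
    · rw [Metric.mem_ball] at hy hz
      linarith [dist_triangle_right y z x]
  · have hP : ζ ∈ PD := mem_PD.2 ⟨lt_of_le_of_ne (mem_PX.1 hζ).1 h1, (mem_PX.1 hζ).2⟩
    exact ⟨ψ ζ, u.diff.continuousOn ζ hP⟩

/-- The uniformization together with its boundary values. -/
structure Ext (γ : ℝ → ℂ) (e : ℂ → ℝ) (Ψ g : ℂ → ℂ) : Prop extends Unif γ e Ψ g where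
  cont : ContinuousOn Ψ PX
  bdry : ∀ ζ, ‖ζ‖ = 1 → Ψ ζ ∈ γ '' Icc 0 1

lemma mem_PX_of_norm {ζ : ℂ} (h : ‖ζ‖ = 1) : ζ ∈ PX := by
  refine mem_PX.2 ⟨h.le, ?_⟩
  rintro rfl
  simp at h

theorem Unif.exists_ext (u : Unif γ e ψ g) : ∃ Ψ, Ext γ e Ψ g := by
  set Ψ := extendFrom PD ψ with hΨ
  have hc : ContinuousOn Ψ PX :=
    continuousOn_extendFrom PX_subset_closure (fun x hx => u.exists_lim hx)
  have heq : ∀ z ∈ PD, Ψ z = ψ z := fun z hz =>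
    extendFrom_eq (subset_closure hz) (u.diff.continuousOn z hz)
  refine ⟨Ψ, ⟨u.arc, u.diff.congr heq, ?_, u.gmaps, ?_, ?_, u.gcont, ?_, u.gtop⟩, hc, ?_⟩
  · intro z hz
    rw [heq z hz]
    exact u.maps hz
  · intro z hz
    rw [heq z hz, u.gψ z hz]
  · intro w hw
    rw [heq _ (u.gmaps hw), u.ψg w hw]
  · refine u.top.congr' ?_
    filter_upwards [mem_nhdsWithin_of_mem_nhds (Metric.ball_mem_nhds (0 : ℂ) one_pos),
      self_mem_nhdsWithin] with z hz hz0
    rw [heq z ⟨hz, hz0⟩]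
  · intro ζ hζ
    by_contra hA
    have hX := mem_PX_of_norm hζ
    have hNB : (𝓝[PD] ζ).NeBot := mem_closure_iff_nhdsWithin_neBot.1 (PX_subset_closure hX)
    obtain ⟨x, hx⟩ := u.exists_lim hX
    have hxe : Ψ ζ = x := extendFrom_eq (PX_subset_closure hX) hx
    rw [hxe] at hA
    have hg : ContinuousAt g x :=
      u.gcont.continuousAt (u.arc.isCompact.isClosed.isOpen_compl.mem_nhds hA)
    have h1 : Tendsto (fun z => g (ψ z)) (𝓝[PD] ζ) (𝓝 (g x)) := hg.tendsto.comp hx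
    have h2 : Tendsto (fun z => g (ψ z)) (𝓝[PD] ζ) (𝓝 ζ) := by
      refine Tendsto.congr' ?_ (tendsto_id.mono_left nhdsWithin_le_nhds)
      filter_upwards [self_mem_nhdsWithin] with z hz
      exact (u.gψ z hz).symm
    have h3 := tendsto_nhds_unique h1 h2
    have h4 := (mem_PD.1 (u.gmaps hA)).1
    rw [h3] at h4
    linarith

lemma IsArc.interior_empty (h : IsArc γ e) : interior (γ '' Icc 0 1) = ∅ := by
  by_contra hne
  obtain ⟨x, hx⟩ := nonempty_iff_ne_empty.2 hne
  obtain ⟨ρ, hρ, hρA⟩ := Metric.isOpen_iff.1 isOpen_interior x hx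
  have hA : ∀ θ : ℝ, x + (ρ / 2 : ℝ) * exp (θ * I) ∈ γ '' Icc 0 1 := by
    intro θ
    apply interior_subset
    apply hρA
    rw [mem_ball_iff_norm, add_sub_cancel_left, norm_mul, norm_exp_ofReal_mul_I, norm_real,
      Real.norm_of_nonneg (half_pos hρ).le]
    linarith
  set v : ℝ → ℝ := fun θ => e (x + (ρ / 2 : ℝ) * exp (θ * I)) with hv
  have hvc : Continuous v := by
    rw [← continuousOn_univ]
    exact h.econt.comp (by fun_prop) (fun θ _ => hA θ)
  have hv2 : v (Real.pi + Real.pi) = v 0 := by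
    simp only [hv]
    congr 3
    push_cast
    rw [← two_mul, exp_two_pi_mul_I]
    simp
  have hinj : ∀ s t : ℝ, v s = v t → exp (s * I) = exp (t * I) := by
    intro s t hst
    have h1 : x + (ρ / 2 : ℝ) * exp (s * I) = x + (ρ / 2 : ℝ) * exp (t * I) := by
      obtain ⟨a, ha, ha2⟩ := hA s
      obtain ⟨b, hb, hb2⟩ := hA t
      simp only [hv] at hst
      rw [← ha2, ← hb2, h.left_inv a ha, h.left_inv b hb] at hst
      rw [← ha2, ← hb2, hst]
    have h2 : ((ρ / 2 : ℝ) : ℂ) ≠ 0 := by exact_mod_cast (half_pos hρ).ne'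
    exact mul_left_cancel₀ h2 (add_left_cancel h1)
  have key : ∃ s : ℝ, v s - v (s + Real.pi) = 0 := by
    have hw : Continuous (fun s => v s - v (s + Real.pi)) := by fun_prop
    have h0 : v Real.pi - v (Real.pi + Real.pi) = -(v 0 - v (0 + Real.pi)) := by
      rw [hv2, zero_add]; ring
    rcases le_total 0 (v 0 - v (0 + Real.pi)) with h1 | h1
    · exact mem_range_of_exists_le_of_exists_ge hw ⟨Real.pi, by rw [h0]; linarith⟩ ⟨0, h1⟩
    · exact mem_range_of_exists_le_of_exists_ge hw ⟨0, h1⟩ ⟨Real.pi, by rw [h0]; linarith⟩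
  obtain ⟨s, hs⟩ := key
  have := hinj _ _ (sub_eq_zero.1 hs)
  push_cast at this
  rw [add_mul, Complex.exp_add, exp_pi_mul_I] at this
  have h3 : exp (s * I) = 0 := by linear_combination this / 2
  exact exp_ne_zero _ h3

lemma Ext.away (E : Ext γ e ψ g) (M : ℝ) : ∃ η > 0, ∀ z ∈ PX, ‖ψ z‖ ≤ M → η ≤ ‖z‖ := by
  have h1 := E.top.eventually_gt_atTop M
  rw [eventually_nhdsWithin_iff] at h1
  obtain ⟨η, hη, h2⟩ := Metric.eventually_nhds_iff.1 h1
  refine ⟨η, hη, fun z hz hM => ?_⟩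
  by_contra! hlt
  have := h2 (y := z) (by simpa using hlt) (mem_PX.1 hz).2
  linarith

/-- The extended uniformization is a proper map. -/
lemma Ext.proper (E : Ext γ e ψ g) : IsProperMap (fun z : PX => ψ z) := by
  rw [isProperMap_iff_isCompact_preimage]
  have hc : Continuous (fun z : PX => ψ z) := continuousOn_iff_continuous_domRestrict.1 E.cont
  refine ⟨hc, fun K hK => ?_⟩
  obtain ⟨M, hM⟩ := hK.isBounded.exists_norm_le
  obtain ⟨η, hη, hη2⟩ := E.away M
  have hcomp : IsCompact (Metric.closedBall (0 : ℂ) 1 ∩ {z | η ≤ ‖z‖}) :=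
    (isCompact_closedBall _ _).inter_right (isClosed_le continuous_const continuous_norm)
  have h1 : IsCompact ((↑) ⁻¹' (Metric.closedBall (0 : ℂ) 1 ∩ {z | η ≤ ‖z‖}) : Set PX) := by
    rw [Subtype.isCompact_iff, Subtype.image_preimage_coe]
    convert hcomp using 1
    apply inter_eq_right.2
    rintro z ⟨hz1, hz2⟩
    refine ⟨hz1, ?_⟩
    rintro rfl
    have : η ≤ ‖(0 : ℂ)‖ := hz2
    rw [norm_zero] at this
    linarith
  refine h1.of_isClosed_subset (hK.isClosed.preimage hc) ?_
  intro z hz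
  exact ⟨z.2.1, hη2 z z.2 (hM _ hz)⟩

lemma Ext.surj (E : Ext γ e ψ g) (w : ℂ) : ∃ z ∈ PX, ψ z = w := by
  have hcl : IsClosed (range (fun z : PX => ψ z)) := E.proper.isClosedMap.isClosed_range
  have hsub : (γ '' Icc 0 1)ᶜ ⊆ range (fun z : PX => ψ z) := by
    intro w hw
    exact ⟨⟨g w, PD_subset_PX (E.gmaps hw)⟩, E.ψg w hw⟩
  have hd : closure (γ '' Icc 0 1)ᶜ = univ := by
    rw [closure_compl, E.arc.interior_empty, compl_empty]
  have : w ∈ range (fun z : PX => ψ z) := by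
    apply closure_minimal hsub hcl
    rw [hd]
    trivial
  obtain ⟨z, hz⟩ := this
  exact ⟨z, z.2, hz⟩

lemma Ext.surj_bdry (E : Ext γ e ψ g) {w : ℂ} (hw : w ∈ γ '' Icc 0 1) :
    ∃ z, ‖z‖ = 1 ∧ ψ z = w := by
  obtain ⟨z, hz, rfl⟩ := E.surj w
  refine ⟨z, ?_, rfl⟩
  by_contra hne
  exact E.maps (mem_PD.2 ⟨lt_of_le_of_ne (mem_PX.1 hz).1 hne, (mem_PX.1 hz).2⟩) hw

end

end ArcExt

end

section
open Set Filter Topology Complex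

namespace ArcExt

/-- Signed side of the line through `c` and `d`. -/
noncomputable def sd (c d z : ℂ) : ℝ := ((z - c) * (starRingEnd ℂ) (d - c)).im

lemma continuous_sd (c d : ℂ) : Continuous (sd c d) := by
  unfold sd
  fun_prop

lemma conj_of_norm {z : ℂ} (hz : ‖z‖ = 1) : (starRingEnd ℂ) z = z⁻¹ := by
  rw [Complex.inv_def, Complex.normSq_eq_norm_sq, hz]
  simp

lemma ne_zero_of_norm {z : ℂ} (hz : ‖z‖ = 1) : z ≠ 0 := by
  rintro rfl
  simp at hz

lemma sd_eq {c d z : ℂ} (hc : ‖c‖ = 1) (hd : ‖d‖ = 1) (hz : ‖z‖ = 1) :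
    (sd c d z : ℂ) = (z - c) * (c - d) * (z - d) / (2 * I * z * c * d) := by
  have hc0 := ne_zero_of_norm hc
  have hd0 := ne_zero_of_norm hd
  have hz0 := ne_zero_of_norm hz
  rw [sd, Complex.im_eq_sub_conj]
  simp only [map_mul, map_sub, conj_of_norm hc, conj_of_norm hd, conj_of_norm hz, map_inv₀, inv_inv]
  field_simp
  ring

lemma sd_eq_zero {c d z : ℂ} (hc : ‖c‖ = 1) (hd : ‖d‖ = 1) (hz : ‖z‖ = 1) (hcd : c ≠ d)
    (h : sd c d z = 0) : z = c ∨ z = d := by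
  have h1 := sd_eq hc hd hz
  have hc0 := ne_zero_of_norm hc
  have hd0 := ne_zero_of_norm hd
  have hz0 := ne_zero_of_norm hz
  rw [h, ofReal_zero, eq_comm, div_eq_zero_iff] at h1
  have h2 : (2 * I * z * c * d) ≠ 0 := by simp [hc0, hd0, hz0]
  have h3 := h1.resolve_right h2
  rcases mul_eq_zero.1 h3 with h4 | h4
  · rcases mul_eq_zero.1 h4 with h5 | h5
    · exact Or.inl (sub_eq_zero.1 h5)
    · exact absurd (sub_eq_zero.1 h5) hcd
  · exact Or.inr (sub_eq_zero.1 h4)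

lemma normSq_sub_of_norm {x y : ℂ} (hx : ‖x‖ = 1) (hy : ‖y‖ = 1) :
    ((‖x - y‖ ^ 2 : ℝ) : ℂ) = - (x - y) ^ 2 / (x * y) := by
  have hx0 := ne_zero_of_norm hx
  have hy0 := ne_zero_of_norm hy
  rw [← Complex.normSq_eq_norm_sq, ← Complex.mul_conj]
  simp only [map_sub, conj_of_norm hx, conj_of_norm hy]
  field_simp
  ring

lemma sd_cross {c d p q : ℂ} (hc : ‖c‖ = 1) (hd : ‖d‖ = 1) (hp : ‖p‖ = 1) (hq : ‖q‖ = 1) :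
    0 ≤ sd c d p * sd c d q * (sd p q c * sd p q d) := by
  have hc0 := ne_zero_of_norm hc
  have hd0 := ne_zero_of_norm hd
  have hp0 := ne_zero_of_norm hp
  have hq0 := ne_zero_of_norm hq
  have key : sd c d p * sd c d q * (sd p q c * sd p q d) =
      1 / 16 * (‖c - d‖ ^ 2 * ‖p - q‖ ^ 2 * ‖c - p‖ ^ 2 * ‖c - q‖ ^ 2 * ‖d - p‖ ^ 2 *
        ‖d - q‖ ^ 2) := by
    apply Complex.ofReal_injective
    rw [ofReal_mul, ofReal_mul, ofReal_mul, sd_eq hc hd hp, sd_eq hc hd hq, sd_eq hp hq hc,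
      sd_eq hp hq hd, ofReal_mul, ofReal_mul, ofReal_mul, ofReal_mul, ofReal_mul, ofReal_mul,
      normSq_sub_of_norm hc hd, normSq_sub_of_norm hp hq, normSq_sub_of_norm hc hp,
      normSq_sub_of_norm hc hq, normSq_sub_of_norm hd hp, normSq_sub_of_norm hd hq]
    have hI : I ^ 4 = 1 := by simp
    push_cast
    field_simp
    rw [hI]
    ring
  rw [key]
  positivity

lemma sd_exists {c d : ℂ} (hc : ‖c‖ = 1) (hd : ‖d‖ = 1) (hcd : c ≠ d) :
    (∃ z, ‖z‖ = 1 ∧ 0 < sd c d z) ∧ ∃ z, ‖z‖ = 1 ∧ sd c d z < 0 := by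
  have hn : 0 < ‖d - c‖ := norm_pos_iff.2 (sub_ne_zero.2 hcd.symm)
  set n := ‖d - c‖ with hn'
  have hn2 : n ^ 2 = 2 - 2 * (c.re * d.re + c.im * d.im) := by
    have h1 : c.re * c.re + c.im * c.im = 1 := by
      rw [← Complex.normSq_apply, Complex.normSq_eq_norm_sq, hc]; norm_num
    have h2 : d.re * d.re + d.im * d.im = 1 := by
      rw [← Complex.normSq_apply, Complex.normSq_eq_norm_sq, hd]; norm_num
    rw [hn', ← Complex.normSq_eq_norm_sq, Complex.normSq_apply]
    simp only [sub_re, sub_im]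
    linarith
  have h3 : (c.re * d.re + c.im * d.im) ^ 2 + (c.im * d.re - c.re * d.im) ^ 2 = 1 := by
    have h1 : c.re * c.re + c.im * c.im = 1 := by
      rw [← Complex.normSq_apply, Complex.normSq_eq_norm_sq, hc]; norm_num
    have h2 : d.re * d.re + d.im * d.im = 1 := by
      rw [← Complex.normSq_apply, Complex.normSq_eq_norm_sq, hd]; norm_num
    calc _ = (c.re * c.re + c.im * c.im) * (d.re * d.re + d.im * d.im) := by ring
      _ = 1 := by rw [h1, h2]; norm_num
  have hlt : |c.im * d.re - c.re * d.im| < n := by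
    apply abs_lt_of_sq_lt_sq _ hn.le
    have : 0 < (1 - (c.re * d.re + c.im * d.im)) := by
      have := pow_pos hn 2
      linarith
    nlinarith [pow_pos this 2]
  rw [abs_lt] at hlt
  have hw : ∀ s : ℝ, sd c d (s * (I * (d - c) / n)) = s * n - (c.im * d.re - c.re * d.im) := by
    intro s
    have h4 : ((s : ℂ) * (I * (d - c) / n) - c) * (starRingEnd ℂ) (d - c)
        = (s * n : ℝ) * I - c * (starRingEnd ℂ) (d - c) := by
      have h5 : (d - c) * (starRingEnd ℂ) (d - c) = (n : ℂ) ^ 2 := by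
        rw [Complex.mul_conj, Complex.normSq_eq_norm_sq]
        push_cast
        rfl
      have hn0 : (n : ℂ) ≠ 0 := by exact_mod_cast hn.ne'
      calc _ = (s : ℂ) * I / n * ((d - c) * (starRingEnd ℂ) (d - c))
            - c * (starRingEnd ℂ) (d - c) := by ring
        _ = _ := by
          rw [h5]
          push_cast
          field_simp
    rw [sd, h4]
    simp
    ring
  have hnorm : ‖I * (d - c) / n‖ = 1 := by
    rw [norm_div, norm_mul, norm_I, one_mul, norm_real, Real.norm_of_nonneg hn.le, div_self hn.ne']
  refine ⟨⟨((1 : ℝ) : ℂ) * (I * (d - c) / n), ?_, ?_⟩,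
    ⟨((-1 : ℝ) : ℂ) * (I * (d - c) / n), ?_, ?_⟩⟩
  · rw [norm_mul, hnorm]; simp
  · rw [hw]; linarith
  · rw [norm_mul, hnorm]; simp
  · rw [hw]; linarith

section
variable {γ : ℝ → ℂ} {e : ℂ → ℝ} {ψ g : ℂ → ℂ}

lemma IsArc.mem_Icc (h : IsArc γ e) {w : ℂ} (hw : w ∈ γ '' Icc 0 1) : e w ∈ Icc (0 : ℝ) 1 := by
  obtain ⟨t, ht, rfl⟩ := hw
  rwa [h.left_inv t ht]

lemma IsArc.right_inv (h : IsArc γ e) {w : ℂ} (hw : w ∈ γ '' Icc 0 1) : γ (e w) = w := by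
  obtain ⟨t, ht, rfl⟩ := hw
  rw [h.left_inv t ht]

lemma Ext.separates (E : Ext γ e ψ g) {q : ℂ → ℝ} (hq : Continuous q) (hq0 : q 0 ≠ 0) {u : ℂ}
    (hu : ∀ ζ, ‖ζ‖ = 1 → q ζ = 0 → ψ ζ = u) {x y : ℂ} (hx : ‖x‖ = 1) (hy : ‖y‖ = 1)
    (hqx : 0 < q x) (hqy : q y < 0) : u ∈ γ '' uIcc (e (ψ x)) (e (ψ y)) := by
  by_contra huC
  set A := γ '' Icc 0 1 with hA
  set Z := Metric.closedBall (0 : ℂ) 1 ∩ {z | q z = 0} with hZ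
  have hZX : Z ⊆ PX := by
    rintro z ⟨hz1, hz2⟩
    refine mem_PX.2 ⟨by simpa using hz1, ?_⟩
    rintro rfl
    exact hq0 hz2
  have hZc : IsCompact Z :=
    (isCompact_closedBall _ _).inter_right (isClosed_eq hq continuous_const)
  set S := ψ '' Z with hS
  have hSc : IsCompact S := hZc.image_of_continuousOn (E.cont.mono hZX)
  have hSA : ∀ w ∈ A, w ∈ S → w = u := by
    rintro w hw ⟨z, hz, rfl⟩
    have h1 := mem_PX.1 (hZX hz)
    rcases h1.1.lt_or_eq with h2 | h2
    · exact absurd hw (E.maps (mem_PD.2 ⟨h2, h1.2⟩))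
    · exact hu z h2 hz.2
  have hsub : (A ∩ S).Subsingleton := by
    rintro a ⟨ha1, ha2⟩ b ⟨hb1, hb2⟩
    rw [hSA a ha1 ha2, hSA b hb1 hb2]
  set C := γ '' uIcc (e (ψ x)) (e (ψ y)) with hC
  have hex := E.arc.mem_Icc (E.bdry x hx)
  have hey := E.arc.mem_Icc (E.bdry y hy)
  have hCA : C ⊆ A := image_mono (uIcc_subset_Icc hex hey)
  have hCS : C ⊆ Sᶜ := fun w hw hwS => huC (hSA w (hCA hw) hwS ▸ hw)
  have hxC : ψ x ∈ C := ⟨_, left_mem_uIcc, E.arc.right_inv (E.bdry x hx)⟩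
  have hyC : ψ y ∈ C := ⟨_, right_mem_uIcc, E.arc.right_inv (E.bdry y hy)⟩
  have hCc : IsPreconnected C := isPreconnected_uIcc.image _ E.arc.cont.continuousOn
  -- nearby interior points
  have near : ∀ ζ, ‖ζ‖ = 1 → ψ ζ ∈ C → ∀ O : Set ℂ, IsOpen O → ζ ∈ O →
      ∃ r > 0, Metric.ball (ψ ζ) r ⊆ Sᶜ ∧ ∃ z ∈ PD, z ∈ O ∧ ψ z ∈ Metric.ball (ψ ζ) r := by
    intro ζ hζ hζC O hO hζO
    obtain ⟨r, hr, hrS⟩ := Metric.isOpen_iff.1 hSc.isClosed.isOpen_compl _ (hCS hζC)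
    refine ⟨r, hr, hrS, ?_⟩
    have hζX := mem_PX_of_norm hζ
    have h1 : ∀ᶠ z in 𝓝[PD] ζ, ψ z ∈ Metric.ball (ψ ζ) r :=
      ((E.cont ζ hζX).mono_left (nhdsWithin_mono _ PD_subset_PX)).eventually
        (Metric.ball_mem_nhds _ hr)
    have h2 : ∀ᶠ z in 𝓝[PD] ζ, z ∈ O := nhdsWithin_le_nhds (hO.mem_nhds hζO)
    have : (𝓝[PD] ζ).NeBot := mem_closure_iff_nhdsWithin_neBot.1 (PX_subset_closure hζX)
    obtain ⟨z, ⟨hz1, hz2⟩, hz3⟩ := ((h1.and h2).and self_mem_nhdsWithin).exists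
    exact ⟨z, hz3, hz2, hz1⟩
  obtain ⟨r, hr, hrS, z, hzD, hzq, hzr⟩ := near x hx hxC {z | 0 < q z}
    (isOpen_lt continuous_const hq) hqx
  obtain ⟨r', hr', hrS', z', hzD', hzq', hzr'⟩ := near y hy hyC {z | q z < 0}
    (isOpen_lt hq continuous_const) hqy
  have n₂ : NS S (ψ z) (ψ z') := by
    refine ⟨Metric.ball (ψ x) r ∪ C ∪ Metric.ball (ψ y) r', ?_, ?_, ?_, ?_⟩
    · refine IsPreconnected.union (ψ y) (Or.inr hyC) (Metric.mem_ball_self hr') ?_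
        (convex_ball _ _).isPreconnected
      exact IsPreconnected.union (ψ x) (Metric.mem_ball_self hr) hxC
        (convex_ball _ _).isPreconnected hCc
    · exact union_subset (union_subset hrS hCS) hrS'
    · exact Or.inl (Or.inl hzr)
    · exact Or.inr hzr'
  have n₁ : NS A (ψ z) (ψ z') :=
    ⟨Aᶜ, E.arc.preconnected_compl, Subset.rfl, E.maps hzD, E.maps hzD'⟩
  obtain ⟨W, hW, hWs, hp, hp'⟩ := janiszewski E.arc.isCompact hSc hsub.isPreconnected n₁ n₂
  have hWA : W ⊆ Aᶜ := fun w hw hwA => hWs hw (Or.inl hwA)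
  have hpre : IsPreconnected ((fun w => q (g w)) '' W) :=
    hW.image _ (hq.comp_continuousOn (E.gcont.mono hWA))
  have hz1 : q z ∈ (fun w => q (g w)) '' W := ⟨_, hp, by simp only [E.gψ z hzD]⟩
  have hz2 : q z' ∈ (fun w => q (g w)) '' W := ⟨_, hp', by simp only [E.gψ z' hzD']⟩
  obtain ⟨w, hw, hw0⟩ := hpre.Icc_subset hz2 hz1 ⟨le_of_lt hzq', le_of_lt hzq⟩
  have hgw := E.gmaps (hWA hw)
  refine hWs hw (Or.inr ⟨g w, ⟨?_, hw0⟩, E.ψg w (hWA hw)⟩)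
  simpa using (mem_PD.1 hgw).1.le

lemma Ext.between (E : Ext γ e ψ g) {c d : ℂ} (hc : ‖c‖ = 1) (hd : ‖d‖ = 1) (hcd : c ≠ d)
    (h : ψ c = ψ d) {x y : ℂ} (hx : ‖x‖ = 1) (hy : ‖y‖ = 1)
    (hqx : 0 < sd c d x) (hqy : sd c d y < 0) : e (ψ c) ∈ uIcc (e (ψ x)) (e (ψ y)) := by
  have key := E.separates (q := fun z => sd c d z + (1 - sd c d 0) * (1 - ‖z‖ ^ 2))
    (u := ψ c) (by have := continuous_sd c d; fun_prop) (by simp) ?_ hx hy (by simpa [hx] using hqx)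
    (by simpa [hy] using hqy)
  · obtain ⟨t, ht, hte⟩ := key
    have htI : t ∈ Icc (0 : ℝ) 1 :=
      uIcc_subset_Icc (E.arc.mem_Icc (E.bdry x hx)) (E.arc.mem_Icc (E.bdry y hy)) ht
    rw [← hte, E.arc.left_inv t htI]
    exact ht
  · intro ζ hζ h0
    simp only [hζ, one_pow, sub_self, mul_zero, add_zero] at h0
    rcases sd_eq_zero hc hd hζ hcd h0 with rfl | rfl
    · rfl
    · exact h.symm

end

end ArcExt

end

section
open Set Filter Topology Complex

namespace ArcExt

/-- A function holomorphic in the punctured disc with zero boundary values vanishes. -/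
lemma eq_zero_of_bdry {F : ℂ → ℂ} (hd : DifferentiableOn ℂ F PD) (hc : ContinuousOn F PX)
    (h0 : ∀ ζ, ‖ζ‖ = 1 → F ζ = 0) {z : ℂ} (hz : z ∈ PD) : F z = 0 := by
  obtain ⟨hz1, hz0⟩ := mem_PD.1 hz
  have hzp : 0 < ‖z‖ := norm_pos_iff.2 hz0
  set r := ‖z‖ / 2 with hr
  have hr0 : 0 < r := by positivity
  have hrz : r < ‖z‖ := by linarith
  have hsph : Metric.sphere (0 : ℂ) r ⊆ PX := by
    intro w hw
    rw [mem_sphere_zero_iff_norm] at hw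
    refine mem_PX.2 ⟨by linarith, norm_pos_iff.1 (by linarith)⟩
  obtain ⟨M, hM⟩ := (isCompact_sphere (0 : ℂ) r).exists_bound_of_continuousOn (hc.mono hsph)
  have hM0 : 0 ≤ M := by
    have := hM r (by simp [hr0.le])
    exact (norm_nonneg _).trans this
  set U := Metric.ball (0 : ℂ) 1 \ Metric.closedBall 0 r with hU
  have hUo : IsOpen U := Metric.isOpen_ball.sdiff Metric.isClosed_closedBall
  have hcl : closure U ⊆ {w | r ≤ ‖w‖ ∧ ‖w‖ ≤ 1} := by
    refine closure_minimal ?_ ((isClosed_le continuous_const continuous_norm).inter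
      (isClosed_le continuous_norm continuous_const))
    rintro w ⟨h1, h2⟩
    simp only [mem_ball_zero_iff] at h1
    simp only [mem_closedBall_zero_iff, not_le] at h2
    exact ⟨h2.le, h1.le⟩
  have hclX : closure U ⊆ PX := by
    intro w hw
    obtain ⟨h1, h2⟩ := hcl hw
    exact mem_PX.2 ⟨h2, norm_pos_iff.1 (by linarith)⟩
  have hUD : U ⊆ PD := by
    rintro w ⟨h1, h2⟩
    simp only [mem_ball_zero_iff] at h1
    simp only [mem_closedBall_zero_iff, not_le] at h2
    exact mem_PD.2 ⟨h1, norm_pos_iff.1 (by linarith)⟩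
  have hzU : z ∈ U := by
    refine ⟨by simpa using hz1, ?_⟩
    simpa using hrz
  have key : ∀ n : ℕ, ‖F z‖ ≤ M * (1 / 2) ^ n := by
    intro n
    have hDC : DiffContOnCl ℂ (fun w => w ^ n * F w) U := by
      refine ⟨(differentiable_pow n).differentiableOn.mul (hd.mono hUD), ?_⟩
      exact (continuous_pow n).continuousOn.mul (hc.mono hclX)
    have hb : ∀ w ∈ frontier U, ‖w ^ n * F w‖ ≤ M * r ^ n := by
      intro w hw
      rw [frontier, hUo.interior_eq] at hw
      obtain ⟨h1, h2⟩ := hcl hw.1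
      rcases h2.lt_or_eq with h3 | h3
      · have h4 : ‖w‖ = r := by
          by_contra hne
          refine hw.2 ⟨by simpa using h3, ?_⟩
          simpa using lt_of_le_of_ne h1 (Ne.symm hne)
        rw [norm_mul, norm_pow, h4, mul_comm]
        gcongr
        exact hM w (by simpa using h4)
      · rw [h0 w h3]
        simp
        positivity
    have hb2 := Complex.norm_le_of_forall_mem_frontier_norm_le
      (Metric.isBounded_ball.subset sdiff_subset) hDC hb (subset_closure hzU)
    rw [norm_mul, norm_pow, hr, div_eq_mul_one_div, mul_pow] at hb2
    have hp : 0 < ‖z‖ ^ n := by positivity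
    have : ‖z‖ ^ n * ‖F z‖ ≤ ‖z‖ ^ n * (M * (1 / 2) ^ n) := by linarith
    exact le_of_mul_le_mul_left this hp
  have ht : Tendsto (fun n : ℕ => M * (1 / 2 : ℝ) ^ n) atTop (𝓝 (M * 0)) :=
    (tendsto_pow_atTop_nhds_zero_of_lt_one (by norm_num) (by norm_num)).const_mul M
  rw [mul_zero] at ht
  have := ge_of_tendsto' ht key
  exact norm_le_zero_iff.1 this

section
variable {γ : ℝ → ℂ} {e : ℂ → ℝ} {ψ g : ℂ → ℂ}

lemma Ext.nonconst (E : Ext γ e ψ g) {O : Set ℂ} (hO : IsOpen O) {ζ₀ : ℂ} (hζ₀ : ‖ζ₀‖ = 1)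
    (hζO : ζ₀ ∈ O) {u : ℂ} (hu : u ∈ γ '' Icc 0 1) : ∃ ζ ∈ O, ‖ζ‖ = 1 ∧ ψ ζ ≠ u := by
  by_contra! hcon
  obtain ⟨T, hT⟩ := (isCompact_sphere (0 : ℂ) 1).elim_finite_subcover
    (fun η : Circle => {z : ℂ | (η : ℂ) * z ∈ O})
    (fun η => hO.preimage (continuous_const.mul continuous_id)) (by
      intro ζ hζ
      rw [mem_sphere_zero_iff_norm] at hζ
      have hζ0 := ne_zero_of_norm hζ
      rw [mem_iUnion]
      refine ⟨⟨ζ₀ / ζ, ?_⟩, ?_⟩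
      · exact mem_sphere_zero_iff_norm.2 (by rw [norm_div, hζ, hζ₀, div_one])
      · change ζ₀ / ζ * ζ ∈ O
        rwa [div_mul_cancel₀ _ hζ0])
  set F : ℂ → ℂ := fun z => ∏ η ∈ T, (ψ ((η : ℂ) * z) - u) with hF
  have hmD : ∀ η : Circle, MapsTo (fun z : ℂ => (η : ℂ) * z) PD PD := by
    intro η z hz
    rw [mem_PD] at hz ⊢
    simpa [Circle.norm_coe] using hz
  have hmX : ∀ η : Circle, MapsTo (fun z : ℂ => (η : ℂ) * z) PX PX := by
    intro η z hz
    rw [mem_PX] at hz ⊢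
    simpa [Circle.norm_coe] using hz
  have hd : DifferentiableOn ℂ F PD := by
    refine DifferentiableOn.fun_finsetProd fun η _ => ?_
    refine DifferentiableOn.sub_const ?_ _
    exact E.diff.comp (by fun_prop) (hmD η)
  have hc : ContinuousOn F PX := by
    refine continuousOn_finsetProd _ fun η _ => ?_
    refine ContinuousOn.sub ?_ continuousOn_const
    exact E.cont.comp (by fun_prop) (hmX η)
  have h0 : ∀ ζ, ‖ζ‖ = 1 → F ζ = 0 := by
    intro ζ hζ
    have := hT (mem_sphere_zero_iff_norm.2 hζ)
    simp only [mem_iUnion] at this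
    obtain ⟨η, hη, hηO⟩ := this
    refine Finset.prod_eq_zero hη ?_
    rw [hcon _ hηO (by simpa [Circle.norm_coe] using hζ), sub_self]
  have hh : (1 / 2 : ℂ) ∈ PD := by
    rw [mem_PD]
    norm_num
  have := eq_zero_of_bdry hd hc h0 hh
  obtain ⟨η, hη, h1⟩ := Finset.prod_eq_zero_iff.1 this
  refine E.maps (hmD η hh) ?_
  rw [sub_eq_zero.1 h1]
  exact hu

/-- Two distinct boundary points with the same image: the two sides go to the two sides. -/
lemma Ext.dichotomy (E : Ext γ e ψ g) {c d : ℂ} (hc : ‖c‖ = 1) (hd : ‖d‖ = 1) (hcd : c ≠ d)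
    (h : ψ c = ψ d) :
    (∃ x y, ‖x‖ = 1 ∧ ‖y‖ = 1 ∧ e (ψ x) < e (ψ c) ∧ e (ψ c) < e (ψ y)) ∧
    ∀ x y, ‖x‖ = 1 → ‖y‖ = 1 → e (ψ x) < e (ψ c) → e (ψ c) < e (ψ y) →
      sd c d x * sd c d y < 0 := by
  have hne : ∀ z, ‖z‖ = 1 → ψ z ≠ ψ c → e (ψ z) ≠ e (ψ c) := by
    intro z hz hne he
    apply hne
    rw [← E.arc.right_inv (E.bdry z hz), he, E.arc.right_inv (E.bdry c hc)]
  obtain ⟨⟨x₀, hx₀, hx₀p⟩, ⟨y₀, hy₀, hy₀n⟩⟩ := sd_exists hc hd hcd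
  obtain ⟨x, hxp, hx, hxne⟩ := E.nonconst (O := {z | 0 < sd c d z})
    (isOpen_lt continuous_const (continuous_sd c d)) hx₀ hx₀p (E.bdry c hc)
  obtain ⟨y, hyn, hy, hyne⟩ := E.nonconst (O := {z | sd c d z < 0})
    (isOpen_lt (continuous_sd c d) continuous_const) hy₀ hy₀n (E.bdry c hc)
  have hxne := hne x hx hxne
  have hyne := hne y hy hyne
  simp only [mem_ofPred_eq] at hxp hyn
  have hb := E.between hc hd hcd h hx hy hxp hyn
  have hz : ∀ z, ‖z‖ = 1 → e (ψ z) ≠ e (ψ c) → sd c d z ≠ 0 := by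
    intro z hz hzne h0
    rcases sd_eq_zero hc hd hz hcd h0 with rfl | rfl
    · exact hzne rfl
    · exact hzne (by rw [h])
  constructor
  · rcases lt_or_gt_of_ne hxne with h1 | h1
    · refine ⟨x, y, hx, hy, h1, ?_⟩
      rcases mem_uIcc.1 hb with ⟨h2, h3⟩ | ⟨h2, h3⟩
      · exact lt_of_le_of_ne h3 (Ne.symm hyne)
      · linarith
    · refine ⟨y, x, hy, hx, ?_, h1⟩
      rcases mem_uIcc.1 hb with ⟨h2, h3⟩ | ⟨h2, h3⟩
      · linarith
      · exact lt_of_le_of_ne h2 hyne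
  · intro p q hp hq hpc hqc
    rcases lt_or_gt_of_ne (hz p hp hpc.ne) with h1 | h1
    · rcases lt_or_gt_of_ne (hz q hq hqc.ne') with h2 | h2
      · exfalso
        have h3 := E.between hc hd hcd h hx hp hxp h1
        have h4 := E.between hc hd hcd h hx hq hxp h2
        rw [mem_uIcc] at h3 h4
        grind
      · exact mul_neg_of_neg_of_pos h1 h2
    · rcases lt_or_gt_of_ne (hz q hq hqc.ne') with h2 | h2
      · exact mul_neg_of_pos_of_neg h1 h2
      · exfalso
        have h3 := E.between hc hd hcd h hp hy h1 hyn
        have h4 := E.between hc hd hcd h hq hy h2 hyn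
        rw [mem_uIcc] at h3 h4
        grind

end

end ArcExt

end

section
open Set Filter Topology Complex

namespace ArcExt

lemma circle_minus_point {c : ℂ} (hc : ‖c‖ = 1) :
    IsPreconnected {z : ℂ | ‖z‖ = 1 ∧ z ≠ c} := by
  have hc0 := ne_zero_of_norm hc
  have h : {z : ℂ | ‖z‖ = 1 ∧ z ≠ c} =
      (fun s : ℝ => -c * exp (s * I)) '' Ioo (-Real.pi) Real.pi := by
    ext z
    simp only [mem_ofPred_eq, mem_image]
    constructor
    · rintro ⟨hz, hzc⟩
      refine ⟨arg (z / (-c)), ⟨neg_pi_lt_arg _, lt_of_le_of_ne (arg_le_pi _) ?_⟩, ?_⟩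
      · intro hpi
        apply hzc
        have h1 := norm_mul_exp_arg_mul_I (z / (-c))
        rw [hpi, norm_div, norm_neg, hz, hc, exp_pi_mul_I] at h1
        simp at h1
        rw [div_neg, eq_comm, neg_inj, div_eq_one_iff_eq hc0] at h1
        exact h1
      · have h1 := norm_mul_exp_arg_mul_I (z / (-c))
        rw [norm_div, norm_neg, hz, hc] at h1
        simp only [div_one, ofReal_one, one_mul] at h1
        rw [h1]
        field_simp
    · rintro ⟨s, hs, rfl⟩
      refine ⟨by rw [norm_mul, norm_neg, hc, norm_exp_ofReal_mul_I, one_mul], ?_⟩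
      intro h1
      have h2 : exp (s * I) = -1 := by
        have h3 : c * (exp (s * I) + 1) = 0 := by linear_combination -h1
        have := (mul_eq_zero.1 h3).resolve_left hc0
        linear_combination this
      have h3 := arg_cos_add_sin_mul_I (θ := s) ⟨hs.1, hs.2.le⟩
      rw [← exp_mul_I, h2, arg_neg_one] at h3
      exact hs.2.ne h3.symm
  rw [h]
  exact isPreconnected_Ioo.image _ (by fun_prop)

/-- The fibre structure on the unit circle. -/
structure Fib (γ : ℝ → ℂ) (e : ℂ → ℝ) (Ψ g : ℂ → ℂ) (a b : ℂ) : Prop extends Ext γ e Ψ g where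
  na : ‖a‖ = 1
  nb : ‖b‖ = 1
  ab : a ≠ b
  zero : ∀ ζ, ‖ζ‖ = 1 → (e (Ψ ζ) = 0 ↔ ζ = a)
  one : ∀ ζ, ‖ζ‖ = 1 → (e (Ψ ζ) = 1 ↔ ζ = b)
  opp : ∀ c d, ‖c‖ = 1 → ‖d‖ = 1 → c ≠ d → e (Ψ c) = e (Ψ d) → sd a b c * sd a b d < 0
  ex : ∀ t ∈ Ioo (0 : ℝ) 1, ∀ s : ℝ, ∃ c, ‖c‖ = 1 ∧ e (Ψ c) = t ∧ 0 ≤ s * sd a b c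

section
variable {γ : ℝ → ℂ} {e : ℂ → ℝ} {ψ g : ℂ → ℂ}

lemma Ext.tau_cont (E : Ext γ e ψ g) : ContinuousOn (fun z => e (ψ z)) (Metric.sphere 0 1) :=
  E.arc.econt.comp (E.cont.mono fun z hz => mem_PX_of_norm (by simpa using hz))
    (fun z hz => E.bdry z (by simpa using hz))

lemma Ext.tau_inj (E : Ext γ e ψ g) {c d : ℂ} (hc : ‖c‖ = 1) (hd : ‖d‖ = 1)
    (h : e (ψ c) = e (ψ d)) : ψ c = ψ d := by
  rw [← E.arc.right_inv (E.bdry c hc), h, E.arc.right_inv (E.bdry d hd)]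

lemma Ext.tau_surj (E : Ext γ e ψ g) {t : ℝ} (ht : t ∈ Icc (0 : ℝ) 1) :
    ∃ c, ‖c‖ = 1 ∧ e (ψ c) = t := by
  obtain ⟨z, hz, h⟩ := E.surj_bdry (mem_image_of_mem γ ht)
  exact ⟨z, hz, by rw [h, E.arc.left_inv t ht]⟩

theorem Ext.exists_fib (E : Ext γ e ψ g) : ∃ a b, Fib γ e ψ g a b := by
  obtain ⟨a, ha, ha0⟩ := E.tau_surj (t := 0) (by simp)
  obtain ⟨b, hb, hb1⟩ := E.tau_surj (t := 1) (by simp)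
  have hab : a ≠ b := by
    rintro rfl
    rw [ha0] at hb1
    norm_num at hb1
  have hzero : ∀ ζ, ‖ζ‖ = 1 → (e (ψ ζ) = 0 ↔ ζ = a) := by
    intro ζ hζ
    refine ⟨fun h => ?_, fun h => h ▸ ha0⟩
    by_contra hne
    obtain ⟨⟨x, y, hx, hy, h1, h2⟩, -⟩ :=
      E.dichotomy hζ ha hne (E.tau_inj hζ ha (h.trans ha0.symm))
    have := (E.arc.mem_Icc (E.bdry x hx)).1
    linarith
  have hone : ∀ ζ, ‖ζ‖ = 1 → (e (ψ ζ) = 1 ↔ ζ = b) := by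
    intro ζ hζ
    refine ⟨fun h => ?_, fun h => h ▸ hb1⟩
    by_contra hne
    obtain ⟨⟨x, y, hx, hy, h1, h2⟩, -⟩ :=
      E.dichotomy hζ hb hne (E.tau_inj hζ hb (h.trans hb1.symm))
    have := (E.arc.mem_Icc (E.bdry y hy)).2
    linarith
  have hopp : ∀ c d, ‖c‖ = 1 → ‖d‖ = 1 → c ≠ d → e (ψ c) = e (ψ d) →
      sd a b c * sd a b d < 0 := by
    intro c d hc hd hcd h
    have hca : c ≠ a := fun hh => hcd (hh.trans ((hzero d hd).1 (h ▸ (hzero c hc).2 hh)).symm)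
    have hcb : c ≠ b := fun hh => hcd (hh.trans ((hone d hd).1 (h ▸ (hone c hc).2 hh)).symm)
    have hda : d ≠ a := fun hh => hca ((hzero c hc).1 (h.trans ((hzero d hd).2 hh)))
    have hdb : d ≠ b := fun hh => hcb ((hone c hc).1 (h.trans ((hone d hd).2 hh)))
    have hI := E.arc.mem_Icc (E.bdry c hc)
    have h1 := (E.dichotomy hc hd hcd (E.tau_inj hc hd h)).2 a b ha hb
      (by rw [ha0]; exact lt_of_le_of_ne hI.1 fun hh => hca ((hzero c hc).1 hh.symm))
      (by rw [hb1]; exact lt_of_le_of_ne hI.2 fun hh => hcb ((hone c hc).1 hh))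
    have h2 := sd_cross hc hd ha hb
    have h3 : sd a b c ≠ 0 := fun hh => (sd_eq_zero ha hb hc hab hh).elim hca hcb
    have h4 : sd a b d ≠ 0 := fun hh => (sd_eq_zero ha hb hd hab hh).elim hda hdb
    refine lt_of_le_of_ne ?_ (mul_ne_zero h3 h4)
    by_contra! hpos
    have := mul_neg_of_neg_of_pos h1 hpos
    linarith
  refine ⟨a, b, E, ha, hb, hab, hzero, hone, hopp, ?_⟩
  intro t ht s
  obtain ⟨c, hc, hct⟩ := E.tau_surj (Ioo_subset_Icc_self ht)
  have hac : a ≠ c := by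
    rintro rfl
    exact ht.1.ne (ha0.symm.trans hct)
  have hbc : b ≠ c := by
    rintro rfl
    exact ht.2.ne' (hb1.symm.trans hct)
  have hpre := (circle_minus_point hc).image (fun z => e (ψ z))
    (E.tau_cont.mono fun z hz => by simpa using hz.1)
  obtain ⟨d, ⟨hd, hdc⟩, hdt⟩ := hpre.Icc_subset ⟨a, ⟨ha, hac⟩, ha0⟩ ⟨b, ⟨hb, hbc⟩, hb1⟩
    (Ioo_subset_Icc_self ht)
  have h1 := hopp d c hd hc hdc (hdt.trans hct.symm)
  by_cases h2 : 0 ≤ s * sd a b c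
  · exact ⟨c, hc, hct, h2⟩
  · refine ⟨d, hd, hdt, ?_⟩
    by_contra h3
    push Not at h2 h3
    have h4 := mul_pos_of_neg_of_neg h2 h3
    have h5 : s * sd a b c * (s * sd a b d) = s ^ 2 * (sd a b d * sd a b c) := by ring
    have h6 : s ^ 2 * (sd a b d * sd a b c) ≤ 0 :=
      mul_nonpos_of_nonneg_of_nonpos (sq_nonneg s) h1.le
    linarith

end

end ArcExt

end

section
open Set Filter Topology Complex

namespace ArcExt

section
variable {γ : ℝ → ℂ} {e : ℂ → ℝ} {ψ g : ℂ → ℂ} {a b : ℂ}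
variable {γ' : ℝ → ℂ} {e' : ℂ → ℝ} {ψ' g' : ℂ → ℂ} {a' b' : ℂ}

lemma Fib.rel_unique (F : Fib γ e ψ g a b) (F' : Fib γ' e' ψ' g' a' b') {ζ ξ ξ' : ℂ}
    (hζ : ‖ζ‖ = 1) (hξ : ‖ξ‖ = 1) (hξ' : ‖ξ'‖ = 1) (h1 : e (ψ ζ) = e' (ψ' ξ))
    (h2 : 0 ≤ sd a b ζ * sd a' b' ξ) (h1' : e (ψ ζ) = e' (ψ' ξ'))
    (h2' : 0 ≤ sd a b ζ * sd a' b' ξ') : ξ = ξ' := by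
  by_contra hne
  have h3 := F'.opp ξ ξ' hξ hξ' hne (h1.symm.trans h1')
  have h4 : sd a b ζ = 0 := by
    have h5 := mul_nonneg h2 h2'
    have h6 : sd a b ζ ^ 2 * (sd a' b' ξ * sd a' b' ξ') ≥ 0 := by nlinarith
    by_contra h7
    have h8 : 0 < sd a b ζ ^ 2 := by positivity
    have := mul_neg_of_pos_of_neg h8 h3
    linarith
  rcases sd_eq_zero F.na F.nb hζ F.ab h4 with h | h
  · have h5 := (F.zero ζ hζ).2 h
    exact hne (((F'.zero ξ hξ).1 (h1.symm.trans h5)).trans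
      ((F'.zero ξ' hξ').1 (h1'.symm.trans h5)).symm)
  · have h5 := (F.one ζ hζ).2 h
    exact hne (((F'.one ξ hξ).1 (h1.symm.trans h5)).trans
      ((F'.one ξ' hξ').1 (h1'.symm.trans h5)).symm)

/-- The matching of the boundary circles. -/
lemma Fib.exists_theta (F : Fib γ e ψ g a b) (F' : Fib γ' e' ψ' g' a' b') :
    ∃ θ : ℂ → ℂ, ContinuousOn θ (Metric.sphere 0 1) ∧ ∀ ζ, ‖ζ‖ = 1 → ‖θ ζ‖ = 1 ∧
      e (ψ ζ) = e' (ψ' (θ ζ)) ∧ 0 ≤ sd a b ζ * sd a' b' (θ ζ) := by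
  have hex : ∀ ζ : ℂ, ∃ ξ : ℂ, ‖ζ‖ = 1 → ‖ξ‖ = 1 ∧
      e (ψ ζ) = e' (ψ' ξ) ∧ 0 ≤ sd a b ζ * sd a' b' ξ := by
    intro ζ
    by_cases hζ : ‖ζ‖ = 1
    swap
    · exact ⟨0, fun h => absurd h hζ⟩
    have hI := F.arc.mem_Icc (F.bdry ζ hζ)
    have hs : ∀ z, (e (ψ z) = 0 ∨ e (ψ z) = 1) → ‖z‖ = 1 → sd a b z = 0 := by
      intro z h hz
      rcases h with h | h
      · rw [(F.zero z hz).1 h]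
        simp [sd]
      · rw [(F.one z hz).1 h]
        simp [sd]
        ring
    rcases hI.1.eq_or_lt with h0 | h0
    · refine ⟨a', fun _ => ⟨F'.na, ?_, ?_⟩⟩
      · rw [(F'.zero a' F'.na).2 rfl, h0]
      · rw [hs ζ (Or.inl h0.symm) hζ, zero_mul]
    rcases hI.2.eq_or_lt with h1 | h1
    · refine ⟨b', fun _ => ⟨F'.nb, ?_, ?_⟩⟩
      · rw [(F'.one b' F'.nb).2 rfl, h1]
      · rw [hs ζ (Or.inr h1) hζ, zero_mul]
    obtain ⟨c, hc, hct, hcs⟩ := F'.ex _ ⟨h0, h1⟩ (sd a b ζ)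
    exact ⟨c, fun _ => ⟨hc, hct.symm, hcs⟩⟩
  choose θ hθ using hex
  refine ⟨θ, ?_, hθ⟩
  rw [continuousOn_iff_isClosed]
  intro t ht
  set s := Metric.sphere (0 : ℂ) 1 with hs
  have hsc : IsCompact s := isCompact_sphere _ _
  have hfst : MapsTo (Prod.fst : ℂ × ℂ → ℂ) (s ×ˢ s) s := fun x hx => hx.1
  have hsnd : MapsTo (Prod.snd : ℂ × ℂ → ℂ) (s ×ˢ s) s := fun x hx => hx.2
  have hf : ContinuousOn (fun x : ℂ × ℂ => e (ψ x.1) - e' (ψ' x.2)) (s ×ˢ s) :=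
    (F.tau_cont.comp continuous_fst.continuousOn hfst).sub
      (F'.tau_cont.comp continuous_snd.continuousOn hsnd)
  have hcl1 : IsClosed (s ×ˢ s ∩ (fun x : ℂ × ℂ => e (ψ x.1) - e' (ψ' x.2)) ⁻¹' {0}) :=
    hf.preimage_isClosed_of_isClosed (hsc.prod hsc).isClosed isClosed_singleton
  have hcl2 : IsClosed {x : ℂ × ℂ | 0 ≤ sd a b x.1 * sd a' b' x.2 ∧ x.2 ∈ t} := by
    have hm : Continuous (fun x : ℂ × ℂ => sd a b x.1 * sd a' b' x.2) := ((continuous_sd a b).comp continuous_fst).mul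
        ((continuous_sd a' b').comp continuous_snd)
    exact (isClosed_le continuous_const hm).inter (ht.preimage continuous_snd)
  have hcomp : IsCompact ((s ×ˢ s ∩ (fun x : ℂ × ℂ => e (ψ x.1) - e' (ψ' x.2)) ⁻¹' {0}) ∩
      {x : ℂ × ℂ | 0 ≤ sd a b x.1 * sd a' b' x.2 ∧ x.2 ∈ t}) :=
    (hsc.prod hsc).of_isClosed_subset (hcl1.inter hcl2) (fun x hx => hx.1.1)
  refine ⟨_, (hcomp.image continuous_fst).isClosed, ?_⟩
  ext ζ
  simp only [mem_inter_iff, mem_preimage, mem_image, Prod.exists, exists_and_right, exists_eq_right,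
    mem_prod, mem_singleton_iff, mem_ofPred_eq]
  constructor
  · rintro ⟨h1, h2⟩
    have hζ : ‖ζ‖ = 1 := by simpa [hs] using h2
    obtain ⟨h3, h4, h5⟩ := hθ ζ hζ
    refine ⟨⟨θ ζ, ⟨⟨h2, by simpa [hs] using h3⟩, sub_eq_zero.2 h4⟩, h5, h1⟩, h2⟩
  · rintro ⟨⟨ξ, ⟨⟨h1, h2⟩, h3⟩, h4, h5⟩, h6⟩
    have hζ : ‖ζ‖ = 1 := by simpa [hs] using h6
    have hξ : ‖ξ‖ = 1 := by simpa [hs] using h2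
    obtain ⟨h7, h8, h9⟩ := hθ ζ hζ
    have := F.rel_unique F' hζ hξ h7 (sub_eq_zero.1 h3) h4 h8 h9
    exact ⟨this ▸ h5, h6⟩

lemma norm_div_norm {z : ℂ} (hz : z ≠ 0) : ‖z / ‖z‖‖ = 1 := by
  rw [norm_div, norm_real, norm_norm, div_self (norm_ne_zero_iff.2 hz)]

/-- Half of the gluing: the map induced on the plane. -/
lemma Fib.exists_map (F : Fib γ e ψ g a b) (F' : Fib γ' e' ψ' g' a' b') {θ : ℂ → ℂ}
    (hθc : ContinuousOn θ (Metric.sphere 0 1))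
    (hθ : ∀ ζ, ‖ζ‖ = 1 → ‖θ ζ‖ = 1 ∧
      e (ψ ζ) = e' (ψ' (θ ζ)) ∧ 0 ≤ sd a b ζ * sd a' b' (θ ζ)) :
    ∃ H : ℂ → ℂ, Continuous H ∧ ∀ z ∈ PX, H (ψ z) = ψ' (‖z‖ * θ (z / ‖z‖)) := by
  have hmap : MapsTo (fun z : ℂ => (‖z‖ : ℂ) * θ (z / ‖z‖)) PX PX := by
    intro z hz
    rw [mem_PX] at hz ⊢
    have h1 := (hθ _ (norm_div_norm hz.2)).1
    refine ⟨?_, ?_⟩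
    · rw [norm_mul, h1, norm_real, norm_norm, mul_one]
      exact hz.1
    · exact mul_ne_zero (by simpa using hz.2) (ne_zero_of_norm h1)
  have hcont : ContinuousOn (fun z : ℂ => (‖z‖ : ℂ) * θ (z / ‖z‖)) PX := by
    refine ContinuousOn.mul (by fun_prop) ?_
    refine hθc.comp ?_ ?_
    · refine ContinuousOn.div continuousOn_id (by fun_prop) ?_
      intro z hz
      simpa using (mem_PX.1 hz).2
    · intro z hz
      simpa using norm_div_norm (mem_PX.1 hz).2
  have hfib : ∀ z ∈ PX, ∀ w ∈ PX, ψ z = ψ w →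
      ψ' (‖z‖ * θ (z / ‖z‖)) = ψ' (‖w‖ * θ (w / ‖w‖)) := by
    intro z hz w hw h
    rcases (mem_PX.1 hz).1.lt_or_eq with h1 | h1
    · have hzD : z ∈ PD := mem_PD.2 ⟨h1, (mem_PX.1 hz).2⟩
      rcases (mem_PX.1 hw).1.lt_or_eq with h2 | h2
      · have hwD : w ∈ PD := mem_PD.2 ⟨h2, (mem_PX.1 hw).2⟩
        rw [F.injOn hzD hwD h]
      · exact absurd (F.bdry w h2) (h ▸ F.maps hzD)
    · rcases (mem_PX.1 hw).1.lt_or_eq with h2 | h2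
      · exact absurd (F.bdry z h1) (h ▸ F.maps (mem_PD.2 ⟨h2, (mem_PX.1 hw).2⟩))
      · simp only [h1, h2, ofReal_one, one_mul, div_one]
        obtain ⟨h3, h4, -⟩ := hθ z h1
        obtain ⟨h5, h6, -⟩ := hθ w h2
        refine F'.tau_inj h3 h5 ?_
        rw [← h4, ← h6, h]
  choose σ hσ hσ2 using F.surj
  have hH : ∀ z ∈ PX, (fun w => ψ' (‖σ w‖ * θ (σ w / ‖σ w‖))) (ψ z) = ψ' (‖z‖ * θ (z / ‖z‖)) :=
    fun z hz => hfib _ (hσ _) z hz (hσ2 _)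
  refine ⟨fun w => ψ' (‖σ w‖ * θ (σ w / ‖σ w‖)), ?_, hH⟩
  have hq : IsQuotientMap (fun z : PX => ψ z) :=
    F.proper.isClosedMap.isQuotientMap F.proper.continuous
      (fun w => ⟨⟨σ w, hσ w⟩, hσ2 w⟩)
  rw [hq.continuous_iff]
  have h1 : ContinuousOn (fun z : ℂ => ψ' (‖z‖ * θ (z / ‖z‖))) PX := F'.cont.comp hcont hmap
  have h2 : Continuous (fun z : PX => ψ' (‖(z : ℂ)‖ * θ (z / ‖(z : ℂ)‖))) :=
    continuousOn_iff_continuous_domRestrict.1 h1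
  refine h2.congr fun z => ?_
  exact (hH z z.2).symm

theorem Fib.exists_homeo (F : Fib γ e ψ g a b) (F' : Fib γ' e' ψ' g' a' b') :
    ∃ H : ℂ ≃ₜ ℂ, ∀ t ∈ Icc (0 : ℝ) 1, H (γ t) = γ' t := by
  obtain ⟨θ, hθc, hθ⟩ := F.exists_theta F'
  obtain ⟨θ', hθc', hθ'⟩ := F'.exists_theta F
  obtain ⟨H, hHc, hH⟩ := F.exists_map F' hθc hθ
  obtain ⟨H', hHc', hH'⟩ := F'.exists_map F hθc' hθ'
  have aux : ∀ (t : ℝ), 0 < t → ∀ ξ : ℂ, ‖ξ‖ = 1 →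
      ‖(t : ℂ) * ξ‖ = t ∧ ((t : ℂ) * ξ) / ‖(t : ℂ) * ξ‖ = ξ := by
    intro t ht ξ hξ
    have h1 : ‖(t : ℂ) * ξ‖ = t := by
      rw [norm_mul, hξ, norm_real, Real.norm_of_nonneg ht.le, mul_one]
    refine ⟨h1, ?_⟩
    rw [h1]
    have : (t : ℂ) ≠ 0 := by exact_mod_cast ht.ne'
    field_simp
  have i1 : ∀ ζ, ‖ζ‖ = 1 → θ' (θ ζ) = ζ := by
    intro ζ hζ
    obtain ⟨h1, h2, h3⟩ := hθ ζ hζ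
    obtain ⟨h4, h5, h6⟩ := hθ' _ h1
    exact F'.rel_unique F h1 h4 hζ h5 h6 h2.symm (by rwa [mul_comm])
  have i2 : ∀ ζ, ‖ζ‖ = 1 → θ (θ' ζ) = ζ := by
    intro ζ hζ
    obtain ⟨h1, h2, h3⟩ := hθ' ζ hζ
    obtain ⟨h4, h5, h6⟩ := hθ _ h1
    exact F.rel_unique F' h1 h4 hζ h5 h6 h2.symm (by rwa [mul_comm])
  have l1 : ∀ w, H' (H w) = w := by
    intro w
    obtain ⟨z, hz, rfl⟩ := F.surj w
    have hz' := mem_PX.1 hz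
    have hn := norm_div_norm hz'.2
    have hp : 0 < ‖z‖ := norm_pos_iff.2 hz'.2
    obtain ⟨h1, h2⟩ := aux ‖z‖ hp _ (hθ _ hn).1
    rw [hH z hz, hH' _ (mem_PX.2 ⟨by rw [h1]; exact hz'.1, norm_pos_iff.1 (by rw [h1]; exact hp)⟩),
      h2, h1, i1 _ hn, mul_div_cancel₀ _ (by exact_mod_cast hp.ne')]
  have l2 : ∀ w, H (H' w) = w := by
    intro w
    obtain ⟨z, hz, rfl⟩ := F'.surj w
    have hz' := mem_PX.1 hz
    have hn := norm_div_norm hz'.2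
    have hp : 0 < ‖z‖ := norm_pos_iff.2 hz'.2
    obtain ⟨h1, h2⟩ := aux ‖z‖ hp _ (hθ' _ hn).1
    rw [hH' z hz, hH _ (mem_PX.2 ⟨by rw [h1]; exact hz'.1, norm_pos_iff.1 (by rw [h1]; exact hp)⟩),
      h2, h1, i2 _ hn, mul_div_cancel₀ _ (by exact_mod_cast hp.ne')]
  refine ⟨⟨⟨H, H', l1, l2⟩, hHc, hHc'⟩, fun t ht => ?_⟩
  change H (γ t) = γ' t
  obtain ⟨c, hc, hct⟩ := F.tau_surj ht
  obtain ⟨h1, h2, -⟩ := hθ c hc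
  have h3 : γ t = ψ c := by rw [← hct, F.arc.right_inv (F.bdry c hc)]
  rw [h3, hH c (mem_PX_of_norm hc), hc, ofReal_one, one_mul, div_one,
    ← F'.arc.right_inv (F'.bdry _ h1), ← h2, hct]

theorem IsArc.exists_homeo (h : IsArc γ e) (h' : IsArc γ' e') :
    ∃ H : ℂ ≃ₜ ℂ, ∀ t ∈ Icc (0 : ℝ) 1, H (γ t) = γ' t := by
  obtain ⟨ψ, g, u⟩ := h.exists_unif
  obtain ⟨Ψ, E⟩ := u.exists_ext
  obtain ⟨a, b, F⟩ := E.exists_fib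
  obtain ⟨ψ', g', u'⟩ := h'.exists_unif
  obtain ⟨Ψ', E'⟩ := u'.exists_ext
  obtain ⟨a', b', F'⟩ := E'.exists_fib
  exact F.exists_homeo F'

end

/-- An arc in the sense of the statement yields `IsArc` data. -/
lemma exists_isArc {A : Set (ℝ × ℝ)} (f : A ≃ₜ Icc (0 : ℝ) 1) :
    ∃ γ e, IsArc γ e ∧ ∀ t : Icc (0 : ℝ) 1,
      γ t = Complex.equivRealProdCLM.symm (f.symm t : ℝ × ℝ) := by
  classical
  have hc0 : Continuous (fun t : Icc (0 : ℝ) 1 =>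
      Complex.equivRealProdCLM.symm (f.symm t : ℝ × ℝ)) :=
    Complex.equivRealProdCLM.symm.continuous.comp
      (continuous_subtype_val.comp f.symm.continuous)
  set γ : ℝ → ℂ := IccExtend zero_le_one (fun t : Icc (0 : ℝ) 1 =>
      Complex.equivRealProdCLM.symm (f.symm t : ℝ × ℝ)) with hγ
  have hγt : ∀ t : Icc (0 : ℝ) 1,
      γ t = Complex.equivRealProdCLM.symm (f.symm t : ℝ × ℝ) := by
    intro t
    rw [hγ, IccExtend_val]
  set e : ℂ → ℝ := fun w => if h : Complex.equivRealProdCLM w ∈ A then (f ⟨_, h⟩ : ℝ) else 0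
    with he
  have hmem : ∀ w ∈ γ '' Icc 0 1, Complex.equivRealProdCLM w ∈ A := by
    rintro _ ⟨t, ht, rfl⟩
    rw [hγt ⟨t, ht⟩, ContinuousLinearEquiv.apply_symm_apply]
    exact Subtype.coe_prop _
  refine ⟨γ, e, ⟨hc0.Icc_extend', ?_, ?_⟩, hγt⟩
  · rw [continuousOn_iff_continuous_domRestrict]
    have h1 : Continuous (fun w : γ '' Icc 0 1 =>
        (f ⟨Complex.equivRealProdCLM w, hmem w w.2⟩ : ℝ)) :=
      continuous_subtype_val.comp (f.continuous.comp
        ((Complex.equivRealProdCLM.continuous.comp continuous_subtype_val).subtype_mk _))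
    refine h1.congr fun w => ?_
    change _ = e w
    rw [he]
    simp only [dif_pos (hmem w w.2)]
  · intro t ht
    have h1 : Complex.equivRealProdCLM (γ t) = (f.symm ⟨t, ht⟩ : ℝ × ℝ) := by
      rw [hγt ⟨t, ht⟩, ContinuousLinearEquiv.apply_symm_apply]
    have h2 : Complex.equivRealProdCLM (γ t) ∈ A := h1 ▸ Subtype.coe_prop _
    rw [he]
    simp only [dif_pos h2]
    have h3 : (⟨_, h2⟩ : A) = f.symm ⟨t, ht⟩ := Subtype.ext h1
    rw [h3, f.apply_symm_apply]

end ArcExt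

end

/-- Any homeomorphism between two arcs in the plane extends to a homeomorphism
of the plane. -/
theorem stmt_4 (A B : Set (ℝ × ℝ))
    (hA : Nonempty (A ≃ₜ (Set.Icc (0 : ℝ) 1)))
    (hB : Nonempty (B ≃ₜ (Set.Icc (0 : ℝ) 1)))
    (h : A ≃ₜ B) :
    ∃ H : (ℝ × ℝ) ≃ₜ (ℝ × ℝ), ∀ a : A, H (a : ℝ × ℝ) = ((h a : B) : ℝ × ℝ) := by
  obtain ⟨f⟩ := hA
  obtain ⟨γ, e, hγ, h1⟩ := ArcExt.exists_isArc f
  obtain ⟨γ', e', hγ', h2⟩ := ArcExt.exists_isArc (h.symm.trans f)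
  obtain ⟨H, hH⟩ := hγ.exists_homeo hγ'
  refine ⟨(Complex.equivRealProdCLM.symm.toHomeomorph.trans H).trans
    Complex.equivRealProdCLM.toHomeomorph, fun a => ?_⟩
  have h3 := hH (f a) (f a).2
  rw [h1, h2, f.symm_apply_apply] at h3
  change Complex.equivRealProdCLM (H (Complex.equivRealProdCLM.symm (a : ℝ × ℝ))) = _
  rw [h3, ContinuousLinearEquiv.apply_symm_apply]
  simp
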